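/- arXiv:1809.10737 — 4 statements merged into one kernel-verified Lean document; each statement's English description precedes it below -/
import Mathlib

section
/- There exist constants c₁, c₂ > 0 such that for every integer n ≥ 4 and every real r with 0 < r ≤ 1, the expected number of unordered pairs of distinct edges of the random geometric graph G(n,r) that cross satisfies c₁·n⁴·r⁶ ≤ E[number of crossing pairs] ≤ c₂·n⁴·r⁶. -/
open MeasureTheory Filter

noncomputable section

/-- The unit square `[0,1]²` in the Euclidean plane. -/
def unitSquare : Set (EuclideanSpace ℝ (Fin 2)) := {x | ∀ i, x i ∈ Set.Icc (0 : ℝ) 1}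

/-- The distribution of `n` independent uniform points in the unit square. -/
def sqMeasure (n : ℕ) : Measure (Fin n → EuclideanSpace ℝ (Fin 2)) :=
  Measure.pi fun _ => volume.restrict unitSquare

/-- The random geometric graph on `n` points `x 0, …, x (n-1)` with distance parameter `r`:
distinct `i`, `j` are adjacent iff `dist (x i) (x j) ≤ r`. -/
def geomGraph (n : ℕ) (r : ℝ) (x : Fin n → EuclideanSpace ℝ (Fin 2)) : SimpleGraph (Fin n) where
  Adj i j := i ≠ j ∧ dist (x i) (x j) ≤ r
  symm := ⟨fun i j h => ⟨h.1.symm, by rw [dist_comm]; exact h.2⟩⟩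
  loopless := ⟨fun i h => h.1 rfl⟩

/-- Two segments `[a,b]` and `[c,d]` cross if they have a common point that is interior to
both segments, i.e. lies on each segment and is distinct from its endpoints. -/
def Crosses (a b c d : EuclideanSpace ℝ (Fin 2)) : Prop :=
  ∃ p, (p ∈ segment ℝ a b ∧ p ≠ a ∧ p ≠ b) ∧ (p ∈ segment ℝ c d ∧ p ≠ c ∧ p ≠ d)

/-- The (straight-line drawing of the) random geometric graph has two crossing edges. -/
def HasCrossing (n : ℕ) (r : ℝ) (x : Fin n → EuclideanSpace ℝ (Fin 2)) : Prop :=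
  ∃ i j k l : Fin n, (geomGraph n r x).Adj i j ∧ (geomGraph n r x).Adj k l ∧
    ({i, j} : Finset (Fin n)) ≠ {k, l} ∧ Crosses (x i) (x j) (x k) (x l)

/-- The number of unordered pairs of distinct edges of the random geometric graph whose
straight-line segments cross. -/
def numCrossingPairs (n : ℕ) (r : ℝ) (x : Fin n → EuclideanSpace ℝ (Fin 2)) : ℕ :=
  Nat.card {S : Finset (Sym2 (Fin n)) //
    ∃ e f : Sym2 (Fin n), e ≠ f ∧ S = {e, f} ∧
      ∃ i j k l : Fin n, e = s(i, j) ∧ f = s(k, l) ∧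
        (geomGraph n r x).Adj i j ∧ (geomGraph n r x).Adj k l ∧
        Crosses (x i) (x j) (x k) (x l)}

abbrev Pt := EuclideanSpace ℝ (Fin 2)

def det3 (a b c : Pt) : ℝ := (b 0 - a 0) * (c 1 - a 1) - (b 1 - a 1) * (c 0 - a 0)

lemma crosses_iff (a b c d : Pt) : Crosses a b c d ↔ a ≠ b ∧ c ≠ d ∧
    ∃ s t : ℝ, s ∈ Set.Ioo (0:ℝ) 1 ∧ t ∈ Set.Ioo (0:ℝ) 1 ∧
      a + s • (b - a) = c + t • (d - c) := by
  have key : ∀ (a b p : Pt), (p ∈ segment ℝ a b ∧ p ≠ a ∧ p ≠ b) ↔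
      a ≠ b ∧ ∃ s : ℝ, s ∈ Set.Ioo (0:ℝ) 1 ∧ a + s • (b - a) = p := by
    intro a b p
    rw [segment_eq_image']
    constructor
    · rintro ⟨⟨s, ⟨h0, h1⟩, rfl⟩, ha, hb⟩
      simp only at ha hb
      refine ⟨fun h => ha (by simp [h]), s, ⟨lt_of_le_of_ne h0 ?_, lt_of_le_of_ne h1 ?_⟩, rfl⟩
      · rintro rfl; simp at ha
      · rintro rfl; simp at hb
    · rintro ⟨hab, s, ⟨h0, h1⟩, rfl⟩
      refine ⟨⟨s, ⟨h0.le, h1.le⟩, rfl⟩, ?_, ?_⟩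
      · simp [h0.ne', sub_eq_zero, hab.symm]
      · intro h
        have h2 : (1 - s) • (a - b) = 0 := by
          have : (1 - s) • (a - b) = (a + s • (b - a)) - b := by module
          rw [this, h, sub_self]
        rw [smul_eq_zero, sub_eq_zero, sub_eq_zero] at h2
        rcases h2 with h2 | h2
        · exact h1.ne h2.symm
        · exact hab h2
  unfold Crosses
  simp only [key]
  constructor
  · rintro ⟨p, ⟨hab, s, hs, rfl⟩, hcd, t, ht, h⟩
    exact ⟨hab, hcd, s, t, hs, ht, h.symm⟩
  · rintro ⟨hab, hcd, s, t, hs, ht, h⟩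
    exact ⟨_, ⟨hab, s, hs, rfl⟩, hcd, t, ht, h.symm⟩

lemma Crosses.swap_left {a b c d : Pt} (h : Crosses a b c d) : Crosses b a c d := by
  obtain ⟨p, ⟨h1, h2, h3⟩, h4⟩ := h
  exact ⟨p, ⟨by rwa [segment_symm], h3, h2⟩, h4⟩

lemma Crosses.swap_right {a b c d : Pt} (h : Crosses a b c d) : Crosses a b d c := by
  obtain ⟨p, h4, ⟨h1, h2, h3⟩⟩ := h
  exact ⟨p, h4, ⟨by rwa [segment_symm], h3, h2⟩⟩

lemma Crosses.det_eq_zero {a b d : Pt} (h : Crosses a b a d) : det3 a b d = 0 := by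
  rw [crosses_iff] at h
  obtain ⟨-, -, s, t, ⟨hs, -⟩, ⟨ht, -⟩, h⟩ := h
  have h0 := congrFun (congrArg WithLp.ofLp h) 0
  have h1 := congrFun (congrArg WithLp.ofLp h) 1
  simp at h0 h1
  unfold det3
  have : s * ((b 0 - a 0) * (d 1 - a 1) - (b 1 - a 1) * (d 0 - a 0)) = 0 := by
    linear_combination (d 1 - a 1) * h0 - (d 0 - a 0) * h1
  exact (mul_eq_zero.1 this).resolve_left hs.ne'

lemma Crosses.dist_le {a b c d : Pt} {r : ℝ} (h : Crosses a b c d) (h1 : dist a b ≤ r)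
    (h2 : dist c d ≤ r) : dist c a ≤ 2 * r := by
  obtain ⟨p, ⟨hp, -⟩, ⟨hq, -⟩⟩ := h
  have e1 := dist_add_dist_of_mem_segment hp
  have e2 := dist_add_dist_of_mem_segment hq
  have := dist_triangle c p a
  have := dist_nonneg (x := p) (y := b)
  have := dist_nonneg (x := p) (y := d)
  rw [dist_comm p a] at *
  linarith

lemma measurableSet_crosses : MeasurableSet {q : Pt × Pt × Pt × Pt |
    Crosses q.1 q.2.1 q.2.2.1 q.2.2.2} := by
  have hK : ∀ m : ℕ, IsClosed {q : Pt × Pt × Pt × Pt | ∃ s t : ℝ,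
      s ∈ Set.Icc (1 / ((m:ℝ) + 1)) (1 - 1 / ((m:ℝ) + 1)) ∧
      t ∈ Set.Icc (1 / ((m:ℝ) + 1)) (1 - 1 / ((m:ℝ) + 1)) ∧
      q.1 + s • (q.2.1 - q.1) = q.2.2.1 + t • (q.2.2.2 - q.2.2.1)} := by
    intro m
    set K := Set.Icc (1 / ((m:ℝ) + 1)) (1 - 1 / ((m:ℝ) + 1)) with hKdef
    have hc : IsClosed {w : (K × K) × (Pt × Pt × Pt × Pt) |
        w.2.1 + (w.1.1 : ℝ) • (w.2.2.1 - w.2.1)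
          = w.2.2.2.1 + (w.1.2 : ℝ) • (w.2.2.2.2 - w.2.2.2.1)} :=
      isClosed_eq (by fun_prop) (by fun_prop)
    have := isClosedMap_snd_of_compactSpace _ hc
    convert this using 1
    ext q
    simp only [Set.mem_ofPred_eq, Set.mem_image, Prod.exists, Subtype.exists, exists_and_left]
    constructor
    · rintro ⟨s, hs, t, ht, h⟩
      exact ⟨s, hs, t, ht, q.1, q.2.1, q.2.2.1, q.2.2.2, h, rfl⟩
    · rintro ⟨s, hs, t, ht, a, b, c, d, h, rfl⟩
      exact ⟨s, hs, t, ht, h⟩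
  have : {q : Pt × Pt × Pt × Pt | Crosses q.1 q.2.1 q.2.2.1 q.2.2.2} =
      {q : Pt × Pt × Pt × Pt | q.1 ≠ q.2.1} ∩ {q | q.2.2.1 ≠ q.2.2.2} ∩
      ⋃ m : ℕ, {q : Pt × Pt × Pt × Pt | ∃ s t : ℝ,
      s ∈ Set.Icc (1 / ((m:ℝ) + 1)) (1 - 1 / ((m:ℝ) + 1)) ∧
      t ∈ Set.Icc (1 / ((m:ℝ) + 1)) (1 - 1 / ((m:ℝ) + 1)) ∧
      q.1 + s • (q.2.1 - q.1) = q.2.2.1 + t • (q.2.2.2 - q.2.2.1)} := by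
    ext q
    simp only [Set.mem_ofPred_eq, crosses_iff, Set.mem_inter_iff, Set.mem_iUnion, and_assoc]
    refine and_congr_right fun _ => and_congr_right fun _ => ?_
    constructor
    · rintro ⟨s, t, hs, ht, h⟩
      obtain ⟨m, hm⟩ := exists_nat_one_div_lt (K := ℝ)
        (ε := min (min s (1 - s)) (min t (1 - t))) (by
          simp only [lt_min_iff, sub_pos]
          exact ⟨hs, ht⟩)
      simp only [lt_min_iff] at hm
      exact ⟨m, s, t, ⟨by linarith, by linarith⟩, ⟨by linarith, by linarith⟩, h⟩
    · rintro ⟨m, s, t, hs, ht, h⟩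
      have : 0 < 1 / ((m:ℝ) + 1) := by positivity
      exact ⟨s, t, ⟨by linarith [hs.1], by linarith [hs.2]⟩,
        ⟨by linarith [ht.1], by linarith [ht.2]⟩, h⟩
  rw [this]
  refine ((IsOpen.measurableSet ?_).inter (IsOpen.measurableSet ?_)).inter
    (MeasurableSet.iUnion fun m => (hK m).measurableSet)
  · exact isOpen_ne_fun (by fun_prop) (by fun_prop)
  · exact isOpen_ne_fun (by fun_prop) (by fun_prop)

/-- geometry of the good configuration -/
lemma good_crosses {a b c d : Pt} {h : ℝ} (hh : 0 < h)
    (hb : dist b (a + h • !₂[4, 0]) ≤ h / 4) (hc : dist c (a + h • !₂[2, 2]) ≤ h / 4)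
    (hd : dist d (a + h • !₂[2, -2]) ≤ h / 4) : Crosses a b c d := by
  have co : ∀ (x v : Pt), dist x (a + h • v) ≤ h / 4 → ∀ i, ∃ u : ℝ, x i = a i + h * (v i + u) ∧
      -(1/4) ≤ u ∧ u ≤ 1/4 := by
    intro x v hx i
    have h1 : |x i - (a + h • v) i| ≤ h / 4 := by
      have := PiLp.norm_apply_le (x - (a + h • v)) i
      rw [dist_eq_norm] at hx
      simpa using this.trans hx
    refine ⟨(x i - a i) / h - v i, by field_simp; ring, ?_⟩
    simp only [PiLp.add_apply, PiLp.smul_apply, smul_eq_mul] at h1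
    have h2 : (x i - a i) / h - v i = (x i - (a i + h * v i)) / h := by field_simp; ring
    rw [h2, div_le_iff₀ hh, le_div_iff₀ hh]
    rw [abs_le] at h1
    constructor <;> linarith
  obtain ⟨b0, eb0, lb0, ub0⟩ := co _ _ hb 0
  obtain ⟨b1, eb1, lb1, ub1⟩ := co _ _ hb 1
  obtain ⟨c0, ec0, lc0, uc0⟩ := co _ _ hc 0
  obtain ⟨c1, ec1, lc1, uc1⟩ := co _ _ hc 1
  obtain ⟨d0, ed0, ld0, ud0⟩ := co _ _ hd 0
  obtain ⟨d1, ed1, ld1, ud1⟩ := co _ _ hd 1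
  simp at eb0 eb1 ec0 ec1 ed0 ed1
  -- D = (b-a) × (c-d), s = (c-a)×(c-d)/D, t = (b-a)×(c-a)/D
  have bd : ∀ x y p q : ℝ, |x| ≤ p → |y| ≤ q → |x * y| ≤ p * q := fun x y p q hx hy => by
    rw [abs_mul]; exact mul_le_mul hx hy (abs_nonneg _) ((abs_nonneg _).trans hx)
  have f1 := abs_le.1 (bd (b1) (c0 - d0) (1/4) (1/2) (abs_le.2 ⟨by linarith, by linarith⟩)
    (abs_le.2 ⟨by linarith, by linarith⟩))
  have f2 := abs_le.1 (bd (b0) (c1 - d1) (1/4) (1/2) (abs_le.2 ⟨by linarith, by linarith⟩)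
    (abs_le.2 ⟨by linarith, by linarith⟩))
  have f3 := abs_le.1 (bd (c0) (c1 - d1) (1/4) (1/2) (abs_le.2 ⟨by linarith, by linarith⟩)
    (abs_le.2 ⟨by linarith, by linarith⟩))
  have f4 := abs_le.1 (bd (c1) (c0 - d0) (1/4) (1/2) (abs_le.2 ⟨by linarith, by linarith⟩)
    (abs_le.2 ⟨by linarith, by linarith⟩))
  have f5 := abs_le.1 (bd (b0) (c1) (1/4) (1/4) (abs_le.2 ⟨by linarith, by linarith⟩)
    (abs_le.2 ⟨by linarith, by linarith⟩))
  have f6 := abs_le.1 (bd (b1) (c0) (1/4) (1/4) (abs_le.2 ⟨by linarith, by linarith⟩)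
    (abs_le.2 ⟨by linarith, by linarith⟩))
  set D := (4 + b0) * (4 + c1 - d1) - b1 * (c0 - d0) with hD
  set S := (2 + c0) * (4 + c1 - d1) - (2 + c1) * (c0 - d0) with hS
  set T := (4 + b0) * (2 + c1) - b1 * (2 + c0) with hT
  have hDpos : 0 < D := by rw [hD]; linarith
  have hSpos : 0 < S := by rw [hS]; linarith
  have hTpos : 0 < T := by rw [hT]; linarith
  have hSD : S < D := by rw [hS, hD]; linarith
  have hTD : T < D := by rw [hT, hD]; linarith
  rw [crosses_iff]
  refine ⟨?_, ?_, S / D, T / D, ⟨by positivity, by rwa [div_lt_one hDpos]⟩,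
    ⟨by positivity, by rwa [div_lt_one hDpos]⟩, ?_⟩
  · intro e
    have : a 0 = b 0 := by rw [e]
    rw [eb0] at this
    have : 0 < h * (4 + b0) := mul_pos hh (by linarith)
    linarith
  · intro e
    have : c 1 = d 1 := by rw [e]
    rw [ec1, ed1] at this
    have : 0 < h * (4 + c1 - d1) := mul_pos hh (by linarith)
    linarith
  · ext i
    fin_cases i
    · simp [eb0, ec0, ed0]
      field_simp
      rw [hS, hT, hD]; ring
    · simp [eb1, ec1, ed1]
      field_simp
      rw [hS, hT, hD]; ring

def mu : Measure Pt := volume.restrict unitSquare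

lemma volume_unitSquare : volume unitSquare = 1 := by
  have : unitSquare = (@WithLp.ofLp 2 (Fin 2 → ℝ)) ⁻¹' (Set.Icc 0 1) := by
    ext x
    simp only [unitSquare, Set.mem_preimage, Set.mem_Icc, Pi.le_def, ← forall_and]
    rfl
  rw [this, (PiLp.volume_preserving_ofLp (Fin 2)).measure_preimage
    measurableSet_Icc.nullMeasurableSet, Real.volume_Icc_pi]
  simp

instance : IsProbabilityMeasure mu := ⟨by simp [mu, volume_unitSquare]⟩

lemma sqMeasure_eq (n : ℕ) : sqMeasure n = Measure.pi fun _ => mu := rfl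

instance (n : ℕ) : IsProbabilityMeasure (sqMeasure n) := by
  rw [sqMeasure_eq]; infer_instance

lemma map_sel {m n : ℕ} (g : Fin m → Fin n) (hg : Function.Injective g) :
    (sqMeasure n).map (fun x i => x (g i)) = sqMeasure m := by
  have h1 : ProbabilityTheory.iIndepFun (fun (i : Fin n) (x : Fin n → Pt) => x i)
      (sqMeasure n) := by
    rw [sqMeasure_eq]
    exact ProbabilityTheory.iIndepFun_pi (X := fun _ => id) (fun _ => aemeasurable_id)
  have h2 := h1.precomp hg
  rw [ProbabilityTheory.iIndepFun_iff_map_fun_eq_pi_map (fun i => (measurable_pi_apply (g i)).aemeasurable)] at h2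
  rw [h2, sqMeasure_eq m]
  congr 1
  ext1 i
  rw [sqMeasure_eq n]
  exact (measurePreserving_eval (fun _ => mu) (g i)).map_eq

lemma measure_sel {m n : ℕ} (g : Fin m → Fin n) (hg : Function.Injective g)
    {A : Set (Fin m → Pt)} (hA : MeasurableSet A) :
    sqMeasure n {x | (fun i => x (g i)) ∈ A} = sqMeasure m A := by
  rw [← map_sel g hg, Measure.map_apply (by fun_prop) hA]
  rfl

lemma succ_mp (m : ℕ) : MeasurePreserving
    (fun y : Fin (m+1) → Pt => (y 0, fun i : Fin m => y i.succ)) (sqMeasure (m+1))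
      (mu.prod (sqMeasure m)) := by
  exact measurePreserving_piFinSuccAbove (α := fun _ => Pt) (fun _ => mu) 0

lemma line_null (a b : Pt) (hab : b ≠ a) : mu {c | det3 a b c = 0} = 0 := by
  refine Measure.absolutelyContinuous_of_le (Measure.restrict_le_self) ?_
  let L : Pt →ₗ[ℝ] ℝ := (b 0 - a 0) • (EuclideanSpace.proj (𝕜 := ℝ) (1 : Fin 2)).toLinearMap -
    (b 1 - a 1) • (EuclideanSpace.proj (𝕜 := ℝ) (0 : Fin 2)).toLinearMap
  have hL : ∀ v, L v = (b 0 - a 0) * v 1 - (b 1 - a 1) * v 0 := fun v => by simp [L]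
  have : {c | det3 a b c = 0} = (fun c => c + (-a)) ⁻¹' (LinearMap.ker L : Set Pt) := by
    ext c
    simp only [Set.mem_preimage, SetLike.mem_coe, LinearMap.mem_ker, hL, ← sub_eq_add_neg]
    rfl
  rw [this, measure_preimage_add_right]
  refine Measure.addHaar_submodule _ _ ?_
  intro htop
  apply hab
  have h0 : L !₂[1, 0] = 0 := by rw [← LinearMap.mem_ker, htop]; trivial
  have h1 : L !₂[0, 1] = 0 := by rw [← LinearMap.mem_ker, htop]; trivial
  rw [hL] at h0 h1
  simp at h0 h1
  ext i
  fin_cases i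
  · simp; linarith
  · simp; linarith

lemma det3_meas : Measurable fun p : Pt × Pt × Pt => det3 p.1 p.2.1 p.2.2 := by
  unfold det3; fun_prop

lemma ae_det3_three : ∀ᵐ y ∂(sqMeasure 3), det3 (y 0) (y 1) (y 2) ≠ 0 := by
  have ms : ∀ (m : ℕ) (f g h : (Fin m → Pt) → Pt), Measurable f → Measurable g → Measurable h →
      MeasurableSet {y | det3 (f y) (g y) (h y) ≠ 0} := fun m f g h hf hg hh =>
    (det3_meas.comp (hf.prodMk (hg.prodMk hh))) (measurableSet_singleton 0).compl
  have s1 : ∀ a b : Pt, b ≠ a → ∀ᵐ z ∂(sqMeasure 1), det3 a b (z 0) ≠ 0 := by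
    intro a b hab
    have := (measurePreserving_eval (fun _ : Fin 1 => mu) 0).quasiMeasurePreserving.ae
      (p := fun c => det3 a b c ≠ 0) (by
        rw [ae_iff]; simpa using line_null a b hab)
    exact this
  have s2 : ∀ a : Pt, ∀ᵐ z ∂(sqMeasure 2), det3 a (z 0) (z 1) ≠ 0 := by
    intro a
    refine (succ_mp 1).quasiMeasurePreserving.ae
      (p := fun w => det3 a w.1 (w.2 0) ≠ 0) ?_
    refine Measure.ae_prod_iff_ae_ae ?_ |>.2 ?_
    · exact (det3_meas.comp (measurable_const.prodMk
        (measurable_fst.prodMk ((measurable_pi_apply 0).comp measurable_snd))))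
          (measurableSet_singleton 0).compl
    · have : ∀ᵐ b ∂mu, b ≠ a := by
        rw [ae_iff]
        simp [mu]
      filter_upwards [this] with b hb
      exact s1 a b hb
  refine (succ_mp 2).quasiMeasurePreserving.ae
      (p := fun w => det3 w.1 (w.2 0) (w.2 1) ≠ 0) ?_
  refine Measure.ae_prod_iff_ae_ae ?_ |>.2 ?_
  · have hm : Measurable (fun w : Pt × (Fin 2 → Pt) => det3 w.1 (w.2 0) (w.2 1)) := by
      unfold det3; fun_prop
    exact hm (measurableSet_singleton 0).compl
  · exact Filter.Eventually.of_forall s2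

lemma ae_det3 (n : ℕ) : ∀ᵐ x ∂(sqMeasure n), ∀ i j k : Fin n, i ≠ j → i ≠ k → j ≠ k →
    det3 (x i) (x j) (x k) ≠ 0 := by
  simp only [ae_all_iff]
  intro i j k hij hik hjk
  have hg : Function.Injective ![i, j, k] := by
    intro p q h
    fin_cases p <;> fin_cases q <;> simp_all
  have mp : MeasurePreserving (fun (x : Fin n → Pt) (p : Fin 3) => x (![i, j, k] p))
    (sqMeasure n) (sqMeasure 3) := ⟨by fun_prop, map_sel _ hg⟩
  exact mp.quasiMeasurePreserving.ae ae_det3_three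

/-- star-shaped box -/
def starBox (A : Set Pt) (v : Fin 3 → Pt) (ρ : Fin 3 → ℝ) : Set (Fin 4 → Pt) :=
  {y | y 0 ∈ A ∧ ∀ i : Fin 3, dist (y i.succ) (y 0 + v i) ≤ ρ i}

lemma star_meas {A : Set Pt} (hA : MeasurableSet A) (v : Fin 3 → Pt) (ρ : Fin 3 → ℝ) :
    MeasurableSet (starBox A v ρ) := by
  refine MeasurableSet.inter (measurable_pi_apply 0 hA) ?_
  have : {y : Fin 4 → Pt | ∀ i : Fin 3, dist (y i.succ) (y 0 + v i) ≤ ρ i} =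
    ⋂ i, {y | dist (y i.succ) (y 0 + v i) ≤ ρ i} := by ext; simp
  change MeasurableSet {y : Fin 4 → Pt | ∀ i : Fin 3, dist (y i.succ) (y 0 + v i) ≤ ρ i}
  rw [this]
  exact MeasurableSet.iInter fun i => measurableSet_le (by fun_prop) (by fun_prop)

lemma star_measure {A : Set Pt} (hA : MeasurableSet A) (v : Fin 3 → Pt) (ρ : Fin 3 → ℝ) :
    sqMeasure 4 (starBox A v ρ) = ∫⁻ a in A, ∏ i, mu (Metric.closedBall (a + v i) (ρ i)) ∂mu := by
  let B : Set (Pt × (Fin 3 → Pt)) := {w | w.1 ∈ A ∧ ∀ i, dist (w.2 i) (w.1 + v i) ≤ ρ i}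
  have hB : MeasurableSet B := by
    refine MeasurableSet.inter (measurable_fst hA) ?_
    have : {w : Pt × (Fin 3 → Pt) | ∀ i : Fin 3, dist (w.2 i) (w.1 + v i) ≤ ρ i} =
      ⋂ i, {w | dist (w.2 i) (w.1 + v i) ≤ ρ i} := by ext; simp
    change MeasurableSet {w : Pt × (Fin 3 → Pt) | ∀ i : Fin 3, dist (w.2 i) (w.1 + v i) ≤ ρ i}
    rw [this]
    exact MeasurableSet.iInter fun i => measurableSet_le (by fun_prop) (by fun_prop)
  have h1 := (succ_mp 3).measure_preimage hB.nullMeasurableSet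
  have h2 : starBox A v ρ = (fun y : Fin 4 → Pt => (y 0, fun i : Fin 3 => y i.succ)) ⁻¹' B := rfl
  rw [h2, h1, Measure.prod_apply hB, ← lintegral_indicator hA]
  congr 1
  ext a
  by_cases ha : a ∈ A
  · rw [Set.indicator_of_mem ha, sqMeasure_eq, ← Measure.pi_pi]
    congr 1
    ext z
    simp [B, ha]
  · rw [Set.indicator_of_notMem ha]
    have : Prod.mk a ⁻¹' B = ∅ := by ext z; simp [B, ha]
    rw [this, measure_empty]

lemma upper_star {r : ℝ} (hr : 0 < r) :
    sqMeasure 4 (starBox Set.univ 0 ![r, 2 * r, 2 * r]) ≤ ENNReal.ofReal (16 * Real.pi ^ 3 * r ^ 6) := by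
  have h2r : 0 ≤ 2 * r := by positivity
  rw [star_measure MeasurableSet.univ]
  have hb : ∀ (a : Pt) (ρ : ℝ), 0 ≤ ρ →
      mu (Metric.closedBall a ρ) ≤ ENNReal.ofReal (ρ ^ 2 * Real.pi) := by
    intro a ρ hρ
    refine (Measure.restrict_apply_le _ _).trans ?_
    rw [EuclideanSpace.volume_closedBall_fin_two, ENNReal.ofReal_mul (by positivity),
      ENNReal.ofReal_pow hρ]
  calc _ ≤ ∫⁻ a in Set.univ, ENNReal.ofReal (16 * Real.pi ^ 3 * r ^ 6) ∂mu := by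
        refine lintegral_mono fun a => ?_
        rw [Fin.prod_univ_three]
        have e : 16 * Real.pi ^ 3 * r ^ 6 =
          (r ^ 2 * Real.pi) * ((2 * r) ^ 2 * Real.pi) * ((2 * r) ^ 2 * Real.pi) := by ring
        rw [e, ENNReal.ofReal_mul (by positivity), ENNReal.ofReal_mul (by positivity)]
        refine mul_le_mul' (mul_le_mul' ?_ ?_) ?_
        · exact hb _ _ hr.le
        · exact hb _ _ h2r
        · exact hb _ _ h2r
    _ = _ := by simp

def ctr : Pt := !₂[1/2, 1/2]

lemma coord_le (x y : Pt) {ρ : ℝ} (h : dist x y ≤ ρ) (i : Fin 2) : |x i - y i| ≤ ρ := by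
  have := PiLp.norm_apply_le (x - y) i
  rw [dist_eq_norm] at h
  simpa using this.trans h

lemma lower_star {r : ℝ} (hr : 0 < r) (hr1 : r ≤ 1) :
    ENNReal.ofReal ((1/8)^2 * Real.pi * (Real.pi ^ 3 * (1/64) ^ 6 * r ^ 6)) ≤
    sqMeasure 4 (starBox (Metric.closedBall ctr (1/8))
      ![(r/16) • !₂[4, 0], (r/16) • !₂[2, 2], (r/16) • !₂[2, -2]] (fun _ => r/16/4)) := by
  have sq : ∀ (a v : Pt) (ρ : ℝ), 0 ≤ ρ → (∀ i, |v i| + ρ ≤ 3/8) → dist a ctr ≤ 1/8 →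
      mu (Metric.closedBall (a + v) ρ) = ENNReal.ofReal (ρ ^ 2 * Real.pi) := by
    intro a v ρ hρ hv ha
    have hsub : Metric.closedBall (a + v) ρ ⊆ unitSquare := by
      intro x hx i
      rw [Metric.mem_closedBall] at hx
      have h1 := abs_le.1 (coord_le _ _ hx i)
      have h2 := abs_le.1 (coord_le _ _ ha i)
      have h3 := hv i
      have h4 := neg_abs_le (v i)
      have h5 := le_abs_self (v i)
      have h6 : ctr i = 1/2 := by fin_cases i <;> simp [ctr]
      rw [h6] at h2
      simp only [PiLp.add_apply] at h1
      constructor <;> linarith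
    rw [mu, Measure.restrict_apply measurableSet_closedBall, Set.inter_eq_left.2 hsub,
      EuclideanSpace.volume_closedBall_fin_two, ENNReal.ofReal_mul (by positivity),
      ENNReal.ofReal_pow hρ]
  rw [star_measure measurableSet_closedBall]
  have hA : mu (Metric.closedBall ctr (1/8)) = ENNReal.ofReal ((1/8)^2 * Real.pi) := by
    have := sq ctr 0 (1/8) (by norm_num) (by intro i; simp; norm_num) (by simp)
    rwa [add_zero] at this
  rw [ENNReal.ofReal_mul (by positivity), ← hA, mul_comm, ← setLIntegral_const]
  refine setLIntegral_mono' measurableSet_closedBall fun a ha => ?_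
  rw [Metric.mem_closedBall] at ha
  rw [Fin.prod_univ_three]
  have hab : |r| = r := abs_of_pos hr
  have k1 := sq a ((r/16) • !₂[4, 0]) (r/16/4) (by positivity) (by
    intro i; fin_cases i <;> simp [abs_mul, hab, abs_div] <;> linarith) ha
  have k2 := sq a ((r/16) • !₂[2, 2]) (r/16/4) (by positivity) (by
    intro i; fin_cases i <;> simp [abs_mul, hab, abs_div] <;> linarith) ha
  have k3 := sq a ((r/16) • !₂[2, -2]) (r/16/4) (by positivity) (by
    intro i; fin_cases i <;> simp [abs_mul, hab, abs_div] <;> linarith) ha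
  have e : Real.pi ^ 3 * (1/64) ^ 6 * r ^ 6 = ((r/16/4)^2 * Real.pi) * ((r/16/4)^2 * Real.pi)
    * ((r/16/4)^2 * Real.pi) := by ring
  rw [e, ENNReal.ofReal_mul (by positivity), ENNReal.ofReal_mul (by positivity)]
  refine mul_le_mul' (mul_le_mul' ?_ ?_) ?_
  · exact k1.ge
  · exact k2.ge
  · exact k3.ge

def CP (n : ℕ) (r : ℝ) (x : Fin n → Pt) (S : Finset (Sym2 (Fin n))) : Prop :=
  ∃ e f : Sym2 (Fin n), e ≠ f ∧ S = {e, f} ∧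
      ∃ i j k l : Fin n, e = s(i, j) ∧ f = s(k, l) ∧
        (geomGraph n r x).Adj i j ∧ (geomGraph n r x).Adj k l ∧
        Crosses (x i) (x j) (x k) (x l)

open Classical in
lemma num_eq (n : ℕ) (r : ℝ) (x : Fin n → Pt) :
    numCrossingPairs n r x = (Finset.univ.filter (fun S => CP n r x S)).card := by
  unfold numCrossingPairs
  rw [Nat.card_eq_fintype_card, Fintype.card_subtype]
  unfold CP
  congr

lemma adj_meas (n : ℕ) (r : ℝ) (i j : Fin n) :
    MeasurableSet {x : Fin n → Pt | (geomGraph n r x).Adj i j} := by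
  refine MeasurableSet.inter (MeasurableSet.const _) ?_
  exact measurableSet_le (f := fun x : Fin n → Pt => dist (x i) (x j)) (by fun_prop) (by fun_prop)

lemma cp_meas (n : ℕ) (r : ℝ) (S : Finset (Sym2 (Fin n))) :
    MeasurableSet {x : Fin n → Pt | CP n r x S} := by
  have : {x : Fin n → Pt | CP n r x S} = ⋃ e : Sym2 (Fin n), ⋃ f : Sym2 (Fin n),
      {x : Fin n → Pt | e ≠ f} ∩ ({x | S = {e, f}} ∩ ⋃ i : Fin n, ⋃ j : Fin n, ⋃ k : Fin n,
      ⋃ l : Fin n, {x | e = s(i, j)} ∩ ({x | f = s(k, l)} ∩ ({x | (geomGraph n r x).Adj i j} ∩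
      ({x | (geomGraph n r x).Adj k l} ∩ {x | Crosses (x i) (x j) (x k) (x l)})))) := by
    ext x
    simp only [CP, Set.mem_ofPred_eq, Set.mem_iUnion, Set.mem_inter_iff]
  rw [this]
  refine .iUnion fun e => .iUnion fun f => .inter (.const _) (.inter (.const _)
    (.iUnion fun i => .iUnion fun j => .iUnion fun k => .iUnion fun l => .inter (.const _)
      (.inter (.const _) (.inter (adj_meas _ _ _ _) (.inter (adj_meas _ _ _ _) ?_)))))
  have hm : Measurable (fun x : Fin n → Pt => (x i, x j, x k, x l)) := by fun_prop
  exact hm measurableSet_crosses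

open Classical in
lemma num_meas (n : ℕ) (r : ℝ) :
    Measurable (fun x : Fin n → Pt => (numCrossingPairs n r x : ℝ)) := by
  have : (fun x : Fin n → Pt => (numCrossingPairs n r x : ℝ)) =
      fun x => ∑ S : Finset (Sym2 (Fin n)), if CP n r x S then (1:ℝ) else 0 := by
    ext x
    rw [num_eq]
    simp
  rw [this]
  exact Finset.measurable_sum _ fun S _ =>
    Measurable.ite (cp_meas n r S) measurable_const measurable_const

open Classical in
lemma num_integrable (n : ℕ) (r : ℝ) :
    Integrable (fun x : Fin n → Pt => (numCrossingPairs n r x : ℝ)) (sqMeasure n) := by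
  refine Integrable.of_bound (num_meas n r).aestronglyMeasurable
    ((Finset.univ : Finset (Finset (Sym2 (Fin n)))).card : ℝ) ?_
  refine Filter.Eventually.of_forall fun x => ?_
  rw [Real.norm_of_nonneg (by positivity), num_eq]
  exact_mod_cast Finset.card_le_card (Finset.filter_subset _ _)

open Classical in
lemma int_count {n : ℕ} {ι : Type} [Fintype ι] (t : ι → Fin 4 → Fin n)
    {A : Set (Fin 4 → Pt)} (hA : MeasurableSet A) (I : Finset ι)
    (hI : ∀ u ∈ I, Function.Injective (t u)) :
    Integrable (fun x : Fin n → Pt => ((I.filter (fun u => (fun m => x (t u m)) ∈ A)).card : ℝ))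
      (sqMeasure n) ∧
    ∫ x, ((I.filter (fun u => (fun m => x (t u m)) ∈ A)).card : ℝ) ∂(sqMeasure n) =
      I.card * (sqMeasure 4).real A := by
  have hms : ∀ u, MeasurableSet {x : Fin n → Pt | (fun m => x (t u m)) ∈ A} := by
    intro u
    have hm : Measurable (fun (x : Fin n → Pt) m => x (t u m)) := by fun_prop
    exact hm hA
  have e : (fun x : Fin n → Pt => ((I.filter (fun u => (fun m => x (t u m)) ∈ A)).card : ℝ)) =
      fun x => ∑ u ∈ I, Set.indicator {x : Fin n → Pt | (fun m => x (t u m)) ∈ A} 1 x := by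
    ext x
    simp [Set.indicator_apply]
  have hi : ∀ u ∈ I, Integrable
      (Set.indicator {x : Fin n → Pt | (fun m => x (t u m)) ∈ A} (1 : (Fin n → Pt) → ℝ))
      (sqMeasure n) := fun u _ => (integrable_const (1:ℝ)).indicator (hms u)
  rw [e]
  refine ⟨integrable_finsetSum _ hi, ?_⟩
  rw [integral_finsetSum _ hi, ← nsmul_eq_mul, ← Finset.sum_const]
  refine Finset.sum_congr rfl fun u hu => ?_
  rw [integral_indicator_one (hms u), Measure.real, Measure.real, measure_sel _ (hI u hu) hA]

open Classical in
lemma upper_count (n : ℕ) (r : ℝ) : ∀ᵐ x ∂(sqMeasure n), numCrossingPairs n r x ≤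
    ((Finset.univ.filter (fun t : Fin 4 → Fin n => Function.Injective t)).filter
      (fun t => (fun m => x (t m)) ∈ starBox Set.univ 0 ![r, 2 * r, 2 * r])).card := by
  filter_upwards [ae_det3 n] with x hx
  rw [num_eq]
  refine (Finset.card_le_card (t := Finset.image
    (fun t : Fin 4 → Fin n => ({s(t 0, t 1), s(t 2, t 3)} : Finset (Sym2 (Fin n)))) _) ?_).trans
      Finset.card_image_le
  intro S hS
  rw [Finset.mem_filter] at hS
  obtain ⟨-, e, f, hef, rfl, i, j, k, l, rfl, rfl, ⟨hij, h1⟩, ⟨hkl, h2⟩, hc⟩ := hS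
  rw [Finset.mem_image]
  refine ⟨![i, j, k, l], ?_, rfl⟩
  have hik : i ≠ k := by
    rintro rfl
    have hjl : j ≠ l := by rintro rfl; exact hef rfl
    exact hx _ _ _ hij hkl hjl hc.det_eq_zero
  have hil : i ≠ l := by
    rintro rfl
    have hjl : j ≠ k := by rintro rfl; exact hef Sym2.eq_swap
    exact hx _ _ _ hij hkl.symm hjl hc.swap_right.det_eq_zero
  have hjk : j ≠ k := by
    rintro rfl
    have hjl : i ≠ l := hil
    exact hx _ _ _ hij.symm hkl hjl hc.swap_left.det_eq_zero
  have hjl : j ≠ l := by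
    rintro rfl
    exact hx _ _ _ hij.symm hkl.symm hik hc.swap_left.swap_right.det_eq_zero
  simp only [Finset.mem_filter, Finset.mem_univ, true_and]
  constructor
  · intro p q h
    fin_cases p <;> fin_cases q <;> simp_all
  · refine ⟨trivial, fun m => ?_⟩
    fin_cases m
    · simpa [dist_comm] using h1
    · simpa using hc.dist_le h1 h2
    · simpa using hc.swap_right.dist_le h1 (by rwa [dist_comm])

def sel {n : ℕ} (u : Fin 4 → Fin (n/4)) (m : Fin 4) : Fin n :=
  ⟨4 * (u m : ℕ) + m, by have := (u m).2; have := m.2; omega⟩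

lemma sel_inj {n : ℕ} (u : Fin 4 → Fin (n/4)) : Function.Injective (sel u) := by
  intro p q h
  simp only [sel, Fin.mk.injEq] at h
  have := p.2
  have := q.2
  ext
  omega

lemma good_star {r : ℝ} (hr : 0 < r) {y : Fin 4 → Pt} (hy : y ∈ starBox (Metric.closedBall ctr (1/8))
      ![(r/16) • !₂[4, 0], (r/16) • !₂[2, 2], (r/16) • !₂[2, -2]] (fun _ => r/16/4)) :
    dist (y 0) (y 1) ≤ r ∧ dist (y 2) (y 3) ≤ r ∧ Crosses (y 0) (y 1) (y 2) (y 3) := by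
  obtain ⟨-, h⟩ := hy
  have h1 : dist (y 1) (y 0 + (r/16) • !₂[4, 0]) ≤ r/16/4 := h 0
  have h2 : dist (y 2) (y 0 + (r/16) • !₂[2, 2]) ≤ r/16/4 := h 1
  have h3 : dist (y 3) (y 0 + (r/16) • !₂[2, -2]) ≤ r/16/4 := h 2
  refine ⟨?_, ?_, good_crosses (by positivity) h1 h2 h3⟩
  · have t1 := dist_triangle (y 1) (y 0 + (r/16) • !₂[4, 0]) (y 0)
    have : dist (y 0 + (r/16) • !₂[4, 0]) (y 0) = r/16 * 4 := by
      rw [dist_eq_norm, add_sub_cancel_left, norm_smul, EuclideanSpace.norm_eq]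
      simp [abs_of_pos hr]
    rw [dist_comm]
    linarith
  · have t1 := dist_triangle4 (y 2) (y 0 + (r/16) • !₂[2, 2]) (y 0 + (r/16) • !₂[2, -2]) (y 3)
    have : dist (y 0 + (r/16) • !₂[2, 2]) (y 0 + (r/16) • !₂[2, -2]) = r/16 * 4 := by
      rw [dist_add_left, dist_eq_norm, ← smul_sub, norm_smul, EuclideanSpace.norm_eq]
      simp [abs_of_pos hr]
      norm_num
    rw [dist_comm (y 0 + (r/16) • !₂[2, -2]) (y 3)] at t1
    linarith

open Classical in
lemma lower_count (n : ℕ) {r : ℝ} (hr : 0 < r) (x : Fin n → Pt) :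
    ((Finset.univ : Finset (Fin 4 → Fin (n/4))).filter
      (fun u => (fun m => x (sel u m)) ∈ starBox (Metric.closedBall ctr (1/8))
      ![(r/16) • !₂[4, 0], (r/16) • !₂[2, 2], (r/16) • !₂[2, -2]] (fun _ => r/16/4))).card
      ≤ numCrossingPairs n r x := by
  rw [num_eq]
  refine Finset.card_le_card_of_injOn
    (fun u => ({s(sel u 0, sel u 1), s(sel u 2, sel u 3)} : Finset (Sym2 (Fin n)))) ?_ ?_
  · intro u hu
    simp only [Finset.coe_filter, Finset.mem_univ, true_and, Set.mem_ofPred_eq] at hu ⊢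
    obtain ⟨h1, h2, h3⟩ := good_star hr hu
    have hi := sel_inj u
    refine ⟨_, _, ?_, rfl, _, _, _, _, rfl, rfl, ⟨hi.ne (by decide), h1⟩,
      ⟨hi.ne (by decide), h2⟩, h3⟩
    intro h
    rw [Sym2.eq_iff] at h
    rcases h with ⟨h, -⟩ | ⟨h, -⟩
    · exact absurd (hi h) (by decide)
    · exact absurd (hi h) (by decide)
  · intro u _ w _ h
    simp only at h
    have m1 : s(sel u 0, sel u 1) ∈ ({s(sel w 0, sel w 1), s(sel w 2, sel w 3)} :
      Finset (Sym2 (Fin n))) := by rw [← h]; simp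
    have m2 : s(sel u 2, sel u 3) ∈ ({s(sel w 0, sel w 1), s(sel w 2, sel w 3)} :
      Finset (Sym2 (Fin n))) := by rw [← h]; simp
    simp only [Finset.mem_insert, Finset.mem_singleton, Sym2.eq_iff, sel, Fin.mk.injEq] at m1 m2
    simp at m1 m2
    ext m
    fin_cases m <;> simp <;> omega

theorem expected_crossings :
    ∃ c₁ c₂ : ℝ, 0 < c₁ ∧ 0 < c₂ ∧
      ∀ n : ℕ, 4 ≤ n → ∀ r : ℝ, 0 < r → r ≤ 1 →
        c₁ * (n : ℝ) ^ 4 * r ^ 6 ≤ ∫ x, (numCrossingPairs n r x : ℝ) ∂(sqMeasure n) ∧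
        ∫ x, (numCrossingPairs n r x : ℝ) ∂(sqMeasure n) ≤ c₂ * (n : ℝ) ^ 4 * r ^ 6 := by
  classical
  refine ⟨(1/8)^4 * ((1/8)^2 * Real.pi * (Real.pi ^ 3 * (1/64) ^ 6)), 16 * Real.pi ^ 3,
    by positivity, by positivity, fun n hn r hr hr1 => ⟨?_, ?_⟩⟩
  · obtain ⟨i1, i2⟩ := int_count (n := n) sel (star_meas (A := Metric.closedBall ctr (1/8))
      measurableSet_closedBall ![(r/16) • !₂[4, 0], (r/16) • !₂[2, 2], (r/16) • !₂[2, -2]]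
      (fun _ => r/16/4)) Finset.univ (fun u _ => sel_inj u)
    have h1 := integral_mono i1 (num_integrable n r)
      (fun x => Nat.cast_le.2 (lower_count n hr x))
    refine le_trans ?_ h1
    rw [i2]
    have h2 := lower_star hr hr1
    rw [ENNReal.ofReal_le_iff_le_toReal (measure_ne_top _ _)] at h2
    have hc : ((1/8) * (n:ℝ))^4 ≤ ((Finset.univ : Finset (Fin 4 → Fin (n/4))).card : ℝ) := by
      simp only [Finset.card_univ, Fintype.card_fun, Fintype.card_fin]
      push_cast
      have : (n:ℝ) ≤ 8 * ((n/4 : ℕ) : ℝ) := by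
        have : n ≤ 8 * (n/4) := by omega
        exact_mod_cast this
      gcongr
      linarith
    calc _ = ((1/8) * (n:ℝ))^4 * ((1/8)^2 * Real.pi * (Real.pi ^ 3 * (1/64) ^ 6 * r ^ 6)) := by ring
      _ ≤ _ := mul_le_mul hc h2 (by positivity) (by positivity)
  · obtain ⟨i1, i2⟩ := int_count (n := n) (fun t : Fin 4 → Fin n => t)
      (star_meas MeasurableSet.univ 0 ![r, 2 * r, 2 * r])
      (Finset.univ.filter (fun t : Fin 4 → Fin n => Function.Injective t))
      (fun u hu => (Finset.mem_filter.1 hu).2)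
    have h1 := integral_mono_ae (num_integrable n r) i1 (by
      filter_upwards [upper_count n r] with x hx
      exact_mod_cast hx)
    refine h1.trans ?_
    rw [i2]
    have h2 : (sqMeasure 4).real (starBox Set.univ 0 ![r, 2 * r, 2 * r]) ≤ 16 * Real.pi ^ 3 * r ^ 6 :=
      ENNReal.toReal_le_of_le_ofReal (by positivity) (upper_star hr)
    have hc : ((Finset.univ.filter (fun t : Fin 4 → Fin n => Function.Injective t)).card : ℝ)
        ≤ (n:ℝ)^4 := by
      have := Finset.card_le_card (Finset.filter_subset (fun t : Fin 4 → Fin n =>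
        Function.Injective t) Finset.univ)
      simp only [Finset.card_univ, Fintype.card_fun, Fintype.card_fin] at this
      exact_mod_cast this
    calc _ ≤ (n:ℝ)^4 * (16 * Real.pi ^ 3 * r ^ 6) :=
          mul_le_mul hc h2 (by positivity) (by positivity)
      _ = _ := by ring
end
end

section
/- Let r : ℕ → ℝ be a positive function. If r(n)·n^{5/8} → 0 as n → ∞, then the probability that every connected component of the random geometric graph G(n, r(n)) has at most 4 vertices (so that in particular G(n, r(n)) contains no subdivision of K₅ or K₃,₃ and is planar) tends to 1. If r(n)·n^{5/8} → ∞ as n → ∞, then the probability that G(n, r(n)) contains a clique on 5 vertices (so that in particular it contains K₅ and is non-planar) tends to 1. -/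
open MeasureTheory Filter

noncomputable section

abbrev EE := EuclideanSpace ℝ (Fin 2)

theorem vol_box_Icc (a b : Fin 2 → ℝ) :
    volume {x : EE | ∀ i, x i ∈ Set.Icc (a i) (b i)} = ∏ i, ENNReal.ofReal (b i - a i) := by
  have h := (EuclideanSpace.volume_preserving_symm_measurableEquiv_toLp (Fin 2)).measure_preimage_equiv
    (Set.univ.pi fun i => Set.Icc (a i) (b i))
  rw [volume_pi_pi] at h
  simp only [Real.volume_Icc] at h
  rw [← h]
  congr 1
  ext x
  simp [Pi.le_def]
  tauto

theorem vol_box_Ico (a b : Fin 2 → ℝ) :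
    volume {x : EE | ∀ i, x i ∈ Set.Ico (a i) (b i)} = ∏ i, ENNReal.ofReal (b i - a i) := by
  have h := (EuclideanSpace.volume_preserving_symm_measurableEquiv_toLp (Fin 2)).measure_preimage_equiv
    (Set.univ.pi fun i => Set.Ico (a i) (b i))
  rw [volume_pi_pi] at h
  simp only [Real.volume_Ico] at h
  rw [← h]
  congr 1
  ext x
  simp

theorem pi_map_inj {Ω : Type*} [MeasurableSpace Ω] (μ : Measure Ω) [IsProbabilityMeasure μ]
    {ι κ : Type*} [Fintype ι] [Fintype κ] (f : κ → ι) (hf : Function.Injective f) :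
    MeasurePreserving (fun (x : ι → Ω) (k : κ) => x (f k))
      (Measure.pi fun _ => μ) (Measure.pi fun _ => μ) := by
  refine ⟨by fun_prop, ?_⟩
  have h1 := ProbabilityTheory.iIndepFun_pi (ι := ι) (μ := fun _ => μ) (X := fun _ => id)
    (fun _ => aemeasurable_id)
  have h2 := h1.precomp hf
  have h3 := (ProbabilityTheory.iIndepFun_iff_map_fun_eq_pi_map (by
    intro i; exact (measurable_pi_apply _).aemeasurable)).1 h2
  simp only [id] at h3
  rw [h3]
  congr 1
  ext1 k
  exact (measurePreserving_eval (fun _ => μ) (f k)).map_eq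

theorem pi_map_curry' {Ω : Type*} [MeasurableSpace Ω] (μ : Measure Ω) [IsProbabilityMeasure μ]
    (ι κ : Type*) [Fintype ι] [Fintype κ] :
    MeasurePreserving (MeasurableEquiv.curry ι κ Ω)
      (Measure.pi fun _ => μ) (Measure.pi fun _ => Measure.pi fun _ => μ) := by
  refine ⟨MeasurableEquiv.measurable _, ?_⟩
  have := Measure.infinitePi_map_curry (ι := ι) (κ := κ) (fun _ _ => μ)
  simpa [Measure.infinitePi_eq_pi] using this

theorem comp_large {n : ℕ} (r : ℝ) (x : Fin n → EE) (hr : 0 < r)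
    (C : (geomGraph n r x).ConnectedComponent) (v : Fin n) (hv : v ∈ C.supp) (k : ℕ)
    (hk : k + 1 ≤ Nat.card C.supp) :
    ∃ S : Finset (Fin n), (S : Set (Fin n)) ⊆ C.supp ∧ S.card = k + 1 ∧ v ∈ S ∧
      ∀ u ∈ S, dist (x v) (x u) ≤ k * r := by
  induction k with
  | zero => exact ⟨{v}, by simpa using hv, by simp, by simp, by simp⟩
  | succ k ih =>
    obtain ⟨S, hS, hc, hvS, hd⟩ := ih (by omega)
    have : ∃ w ∈ C.supp, w ∉ S := by
      by_contra! h
      have h1 : C.supp ⊆ S := h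
      have h2 := Set.ncard_le_ncard h1
      rw [Set.ncard_coe_finset, ← Nat.card_coe_set_eq] at h2
      omega
    obtain ⟨w, hw, hwS⟩ := this
    have hreach : (geomGraph n r x).Reachable v w := C.reachable_of_mem_supp hv hw
    obtain ⟨p⟩ := hreach
    obtain ⟨d, -, h1, h2⟩ := p.exists_boundary_dart (S : Set (Fin n)) hvS hwS
    have had := d.adj
    refine ⟨insert d.snd S, ?_, ?_, by simp [hvS], ?_⟩
    · intro u hu
      simp only [Finset.coe_insert, Set.mem_insert_iff] at hu
      rcases hu with rfl | hu
      · exact C.mem_supp_of_adj_mem_supp (hS h1) had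
      · exact hS hu
    · rw [Finset.card_insert_of_notMem (by simpa using h2), hc]
    · intro u hu
      rw [Finset.mem_insert] at hu
      push_cast
      rcases hu with rfl | hu
      · have := dist_triangle (x v) (x d.fst) (x d.snd)
        have h3 := hd _ h1
        have h4 : dist (x d.fst) (x d.snd) ≤ r := had.2
        linarith
      · have := hd _ hu
        linarith

theorem star_meas_s13 (μ : Measure EE) [IsProbabilityMeasure μ] (hμ : μ ≤ volume) (R : ℝ) :
    (Measure.pi fun _ : Fin 5 => μ) {y | ∀ j, dist (y 0) (y j) ≤ R} ≤
      (ENNReal.ofReal R ^ 2 * ENNReal.ofReal Real.pi) ^ 4 := by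
  have hmp := measurePreserving_piFinSuccAbove (n := 4) (fun _ : Fin 5 => μ) 0
  have hsub : {y : Fin 5 → EE | ∀ j, dist (y 0) (y j) ≤ R} ⊆
      (MeasurableEquiv.piFinSuccAbove (fun _ : Fin 5 => EE) 0) ⁻¹'
        {z : EE × (Fin 4 → EE) | ∀ j, dist z.1 (z.2 j) ≤ R} := by
    intro y hy j
    exact hy (Fin.succ j)
  refine (measure_mono hsub).trans ?_
  have hmeas : MeasurableSet {z : EE × (Fin 4 → EE) | ∀ j, dist z.1 (z.2 j) ≤ R} := by
    simp only [Set.ofPred_forall]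
    refine MeasurableSet.iInter fun j => ?_
    exact measurableSet_le (by fun_prop) (by fun_prop)
  rw [hmp.measure_preimage_equiv, Measure.prod_apply hmeas]
  calc _ ≤ ∫⁻ a, (ENNReal.ofReal R ^ 2 * ENNReal.ofReal Real.pi) ^ 4 ∂μ := by
        refine lintegral_mono fun a => ?_
        have : (Prod.mk a ⁻¹' {z : EE × (Fin 4 → EE) | ∀ j, dist z.1 (z.2 j) ≤ R}) =
          Set.univ.pi fun _ => Metric.closedBall a R := by
          ext z; simp [Set.mem_pi, dist_comm]
        simp only [this]
        rw [Measure.pi_pi]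
        simp only [Finset.prod_const, Finset.card_univ, Fintype.card_fin]
        gcongr
        refine (hμ _).trans ?_
        rw [EuclideanSpace.volume_closedBall_fin_two]
    _ = _ := by simp

instance sqProb : IsProbabilityMeasure ((volume : Measure EE).restrict unitSquare) := by
  refine ⟨?_⟩
  rw [Measure.restrict_apply_univ]
  have := vol_box_Icc (fun _ => 0) (fun _ => 1)
  simpa [unitSquare] using this

instance sqMeasProb (n : ℕ) : IsProbabilityMeasure (sqMeasure n) := by
  unfold sqMeasure; infer_instance

/-- cell of the grid -/
def cell (k : ℕ) (a : Fin 2 → Fin k) : Set EE :=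
  {x | ∀ i, x i ∈ Set.Ico (((a i : ℕ) : ℝ) / k) ((((a i : ℕ) : ℝ) + 1) / k)}

theorem cell_meas (k : ℕ) (a : Fin 2 → Fin k) : MeasurableSet (cell k a) := by
  simp only [cell, Set.ofPred_forall]
  refine MeasurableSet.iInter fun j => ?_
  have : Measurable fun x : EE => x j := by fun_prop
  exact this measurableSet_Ico

theorem cell_vol (k : ℕ) (a : Fin 2 → Fin k) :
    (volume.restrict unitSquare).real (cell k a) = 1 / (k : ℝ) ^ 2 := by
  have hk : 0 < k := (a 0).pos
  have hk' : (0 : ℝ) < k := by exact_mod_cast hk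
  have hsub : cell k a ⊆ unitSquare := by
    intro x hx i
    have h := hx i
    have h1 : ((a i : ℕ) : ℝ) + 1 ≤ k := by exact_mod_cast (a i).2
    have h2 : (((a i : ℕ) : ℝ) + 1) / k ≤ 1 := by rw [div_le_one hk']; exact h1
    exact ⟨le_trans (by positivity) h.1, by linarith [h.2]⟩
  rw [measureReal_restrict_apply (cell_meas k a), Set.inter_eq_left.2 hsub, Measure.real,
    cell, vol_box_Ico]
  have : ∀ i, ((((a i : ℕ) : ℝ) + 1) / k - ((a i : ℕ) : ℝ) / k) = 1 / k := by
    intro i; ring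
  simp only [this, Fin.prod_univ_two]
  rw [← ENNReal.ofReal_mul (by positivity), ENNReal.toReal_ofReal (by positivity)]
  ring

theorem cell_disj (k : ℕ) (a b : Fin 2 → Fin k) (x : EE) (ha : x ∈ cell k a) (hb : x ∈ cell k b) :
    a = b := by
  ext i
  have hk : 0 < k := (a 0).pos
  have hk' : (0 : ℝ) < k := by exact_mod_cast hk
  have h1 := ha i
  have h2 := hb i
  simp only [Set.mem_Ico, div_le_iff₀ hk', lt_div_iff₀ hk'] at h1 h2
  have h3 : ((a i : ℕ) : ℝ) < (b i : ℕ) + 1 := by linarith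
  have h4 : ((b i : ℕ) : ℝ) < (a i : ℕ) + 1 := by linarith
  norm_cast at h3 h4
  omega

theorem cell_dist (k : ℕ) (a : Fin 2 → Fin k) (x y : EE) (hx : x ∈ cell k a) (hy : y ∈ cell k a) :
    dist x y ≤ 2 / k := by
  have hk : 0 < k := (a 0).pos
  have hk' : (0 : ℝ) < k := by exact_mod_cast hk
  have key : ∀ i, (dist (x i) (y i)) ^ 2 ≤ (1 / (k : ℝ)) ^ 2 := by
    intro i
    have h1 := hx i
    have h2 := hy i
    have e : (((a i : ℕ) : ℝ) + 1) / k = ((a i : ℕ) : ℝ) / k + 1 / k := by ring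
    simp only [Set.mem_Ico, e] at h1 h2
    gcongr
    rw [Real.dist_eq, abs_le]
    constructor <;> linarith
  rw [EuclideanSpace.dist_eq, Fin.sum_univ_two]
  apply Real.sqrt_le_iff.2
  refine ⟨by positivity, ?_⟩
  have e : (2 / (k : ℝ)) ^ 2 = 4 * (1 / (k : ℝ)) ^ 2 := by ring
  rw [e]
  nlinarith [key 0, key 1, sq_nonneg (1 / (k : ℝ))]

/-- number of points in a set -/
def cnt {Ω : Type*} {m : ℕ} (C : Set Ω) (y : Fin m → Ω) : ℝ :=
  ∑ i, C.indicator (fun _ => (1 : ℝ)) (y i)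

section second
variable {Ω : Type*} [MeasurableSpace Ω] (μ : Measure Ω) [IsProbabilityMeasure μ]

theorem cnt_meas {m : ℕ} {C : Set Ω} (hC : MeasurableSet C) :
    Measurable (cnt (m := m) C) := by
  unfold cnt
  have : Measurable (C.indicator (fun _ => (1 : ℝ))) := measurable_const.indicator hC
  fun_prop

theorem cnt_bound {Ω : Type*} {m : ℕ} (C : Set Ω) (y : Fin m → Ω) : 0 ≤ cnt C y ∧ cnt C y ≤ m := by
  unfold cnt
  constructor
  · exact Finset.sum_nonneg fun i _ => Set.indicator_nonneg (by simp) _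
  · calc _ ≤ ∑ i : Fin m, (1 : ℝ) := Finset.sum_le_sum fun i _ => by
          unfold Set.indicator; split_ifs <;> norm_num
      _ = _ := by simp

theorem int_ind {m : ℕ} {C : Set Ω} (hC : MeasurableSet C) (i : Fin m) :
    ∫ y, C.indicator (fun _ => (1 : ℝ)) (y i) ∂(Measure.pi fun _ : Fin m => μ) = μ.real C := by
  have h := (measurePreserving_eval (fun _ : Fin m => μ) i)
  have hm : Measurable (C.indicator (fun _ => (1 : ℝ))) := measurable_const.indicator hC
  have h2 := integral_map (μ := Measure.pi fun _ : Fin m => μ) (φ := Function.eval i)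
    h.measurable.aemeasurable
    (f := C.indicator (fun _ => (1 : ℝ))) hm.aestronglyMeasurable
  rw [h.map_eq] at h2
  simp only [Function.eval] at h2
  rw [← h2]
  simp [integral_indicator hC]

theorem integrable_ind {m : ℕ} {C : Set Ω} (hC : MeasurableSet C) (i : Fin m) :
    Integrable (fun y => C.indicator (fun _ => (1 : ℝ)) (y i)) (Measure.pi fun _ : Fin m => μ) := by
  have hm : Measurable (C.indicator (fun _ => (1 : ℝ))) := measurable_const.indicator hC
  refine Integrable.of_bound (C := 1) (hm.comp (measurable_pi_apply _)).aestronglyMeasurable (ae_of_all _ fun y => ?_)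
  unfold Set.indicator; split_ifs <;> norm_num

theorem integrable_ind2 {m : ℕ} {C D : Set Ω} (hC : MeasurableSet C) (hD : MeasurableSet D)
    (i j : Fin m) :
    Integrable (fun y => C.indicator (fun _ => (1 : ℝ)) (y i) * D.indicator (fun _ => (1 : ℝ)) (y j))
      (Measure.pi fun _ : Fin m => μ) := by
  have hm : Measurable (C.indicator (fun _ => (1 : ℝ))) := measurable_const.indicator hC
  have hm2 : Measurable (D.indicator (fun _ => (1 : ℝ))) := measurable_const.indicator hD
  refine Integrable.of_bound (C := 1) ((hm.comp (measurable_pi_apply _)).mul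
    (hm2.comp (measurable_pi_apply _))).aestronglyMeasurable (ae_of_all _ fun y => ?_)
  unfold Set.indicator; split_ifs <;> norm_num

theorem int_ind2 {m : ℕ} {C D : Set Ω} (hC : MeasurableSet C) (hD : MeasurableSet D)
    (i j : Fin m) (hij : i ≠ j) :
    ∫ y, C.indicator (fun _ => (1 : ℝ)) (y i) * D.indicator (fun _ => (1 : ℝ)) (y j)
      ∂(Measure.pi fun _ : Fin m => μ) = μ.real C * μ.real D := by
  have hm : Measurable (C.indicator (fun _ => (1 : ℝ))) := measurable_const.indicator hC
  have hm2 : Measurable (D.indicator (fun _ => (1 : ℝ))) := measurable_const.indicator hD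
  have h1 := ProbabilityTheory.iIndepFun_pi (ι := Fin m) (μ := fun _ => μ) (X := fun _ => id)
    (fun _ => aemeasurable_id)
  have h2 := (h1.indepFun hij).comp hm hm2
  have h3 := h2.integral_fun_mul_eq_mul_integral
    (hm.comp (measurable_pi_apply _)).aestronglyMeasurable
    (hm2.comp (measurable_pi_apply _)).aestronglyMeasurable
  simp only [Function.comp_def, id] at h3
  rw [h3, int_ind μ hC, int_ind μ hD]

theorem int_cnt {m : ℕ} {C : Set Ω} (hC : MeasurableSet C) :
    ∫ y, cnt C y ∂(Measure.pi fun _ : Fin m => μ) = m * μ.real C := by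
  unfold cnt
  rw [integral_finsetSum _ fun i _ => integrable_ind μ hC i]
  simp [int_ind μ hC]

theorem int_cnt2 {m : ℕ} {C D : Set Ω} (hC : MeasurableSet C) (hD : MeasurableSet D) (p q : ℝ)
    (hCp : μ.real C = p) (hDp : μ.real D = p) (hq : μ.real (C ∩ D) = q) :
    ∫ y, cnt C y * cnt D y ∂(Measure.pi fun _ : Fin m => μ) ≤ (m * p) ^ 2 + m * q := by
  unfold cnt
  simp only [Finset.sum_mul_sum]
  rw [integral_finsetSum _ fun i _ => integrable_finsetSum _ fun j _ => integrable_ind2 μ hC hD i j]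
  simp_rw [integral_finsetSum _ fun j _ => integrable_ind2 μ hC hD _ j]
  have key : ∀ i j : Fin m, ∫ y, C.indicator (fun _ => (1 : ℝ)) (y i) *
      D.indicator (fun _ => (1 : ℝ)) (y j) ∂(Measure.pi fun _ : Fin m => μ) ≤
      p ^ 2 + if i = j then q else 0 := by
    intro i j
    split_ifs with h
    · subst h
      have : ∀ z : Ω, C.indicator (fun _ => (1 : ℝ)) z * D.indicator (fun _ => (1 : ℝ)) z =
        (C ∩ D).indicator (fun _ => (1 : ℝ)) z := by
        intro z
        by_cases h1 : z ∈ C <;> by_cases h2 : z ∈ D <;> simp [h1, h2]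
      simp only [this]
      rw [int_ind μ (hC.inter hD), hq]
      nlinarith [sq_nonneg p]
    · rw [int_ind2 μ hC hD i j h, hCp, hDp]
      linarith [sq p]
  refine (Finset.sum_le_sum fun i _ => Finset.sum_le_sum fun j _ => key i j).trans (le_of_eq ?_)
  simp [Finset.sum_add_distrib]
  ring

theorem second_moment {m : ℕ} {ι : Type*} [Fintype ι] [DecidableEq ι] (C : ι → Set Ω)
    (hC : ∀ a, MeasurableSet (C a)) (hdisj : ∀ a b x, x ∈ C a → x ∈ C b → a = b) (p M l : ℝ)
    (hp : ∀ a, μ.real (C a) = p) (hM : M = Fintype.card ι) (hl : l = m * p)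
    (hM0 : 0 < M) (hl0 : 0 < l) :
    (Measure.pi fun _ : Fin 5 => Measure.pi fun _ : Fin m => μ)
      {y | ¬ ∃ c, ∀ g, ∃ i, y g i ∈ C c} ≤
      ENNReal.ofReal (M * (l ^ 2 + l) ^ 5 / (M * l ^ 5) ^ 2) := by
  set P := (Measure.pi fun _ : Fin 5 => Measure.pi fun _ : Fin m => μ) with hP
  set Z : (Fin 5 → Fin m → Ω) → ℝ := fun y => ∑ c, ∏ g, cnt (C c) (y g) with hZ
  have hmT : ∀ c, Measurable fun y : Fin 5 → Fin m → Ω => ∏ g, cnt (C c) (y g) := fun c =>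
    Finset.measurable_fun_prod _ fun g _ => (cnt_meas (hC c)).comp (measurable_pi_apply g)
  have hbT : ∀ c (y : Fin 5 → Fin m → Ω), ‖∏ g, cnt (C c) (y g)‖ ≤ (m : ℝ) ^ 5 := by
    intro c y
    rw [Real.norm_of_nonneg (Finset.prod_nonneg fun g _ => (cnt_bound (C c) (y g)).1)]
    refine (Finset.prod_le_prod (fun g _ => (cnt_bound (C c) (y g)).1)
      (fun g _ => (cnt_bound (C c) (y g)).2)).trans (le_of_eq ?_)
    simp
  have hLT : ∀ c, MemLp (fun y : Fin 5 → Fin m → Ω => ∏ g, cnt (C c) (y g)) 2 P := fun c =>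
    MemLp.of_bound (hmT c).aestronglyMeasurable _ (ae_of_all _ (hbT c))
  have hL : MemLp Z 2 P := memLp_finsetSum _ fun c _ => hLT c
  have hE : ∫ y, Z y ∂P = M * l ^ 5 := by
    rw [hZ, integral_finsetSum _ fun c _ => (hLT c).integrable (by norm_num)]
    have : ∀ c, ∫ y, ∏ g, cnt (C c) (y g) ∂P = l ^ 5 := by
      intro c
      rw [hP, integral_fintype_prod_eq_prod (fun _ : Fin 5 => cnt (m := m) (C c))]
      simp [int_cnt μ (hC c), hp, hl]
    simp [this, hM]
  have hE2 : ∫ y, (Z y) ^ 2 ∂P ≤ (M * l ^ 5) ^ 2 + M * (l ^ 2 + l) ^ 5 := by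
    have e : ∀ y, (Z y) ^ 2 = ∑ c, ∑ d, ((∏ g, cnt (C c) (y g)) * ∏ g, cnt (C d) (y g)) := by
      intro y
      rw [sq, hZ, Finset.sum_mul_sum]
    have hi : ∀ c d, Integrable (fun y : Fin 5 → Fin m → Ω =>
        (∏ g, cnt (C c) (y g)) * ∏ g, cnt (C d) (y g)) P := fun c d =>
      (hLT c).integrable_mul (hLT d)
    simp_rw [e]
    rw [integral_finsetSum _ fun c _ => integrable_finsetSum _ fun d _ => hi c d]
    simp_rw [integral_finsetSum _ fun d _ => hi _ d]
    have key : ∀ c d, ∫ y, (∏ g, cnt (C c) (y g)) * ∏ g, cnt (C d) (y g) ∂P ≤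
        l ^ 10 + if c = d then (l ^ 2 + l) ^ 5 else 0 := by
      intro c d
      simp_rw [← Finset.prod_mul_distrib]
      rw [hP, integral_fintype_prod_eq_prod
        (fun _ : Fin 5 => fun z : Fin m → Ω => cnt (C c) z * cnt (C d) z)]
      simp only [Finset.prod_const, Finset.card_univ, Fintype.card_fin]
      have h0 : 0 ≤ ∫ z, cnt (C c) z * cnt (C d) z ∂(Measure.pi fun _ : Fin m => μ) :=
        integral_nonneg fun z => mul_nonneg (cnt_bound (C c) z).1 (cnt_bound (C d) z).1
      split_ifs with h
      · subst h
        have h1 := int_cnt2 μ (m := m) (hC c) (hC c) p p (hp c) (hp c) (by simp [hp])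
        rw [← hl] at h1
        have := pow_le_pow_left₀ h0 h1 5
        have : 0 ≤ l ^ 10 := by positivity
        linarith
      · have hem : C c ∩ C d = ∅ := by
          ext x; simp only [Set.mem_inter_iff, Set.mem_empty_iff_false, iff_false]
          exact fun hx => h (hdisj c d x hx.1 hx.2)
        have h1 := int_cnt2 μ (m := m) (hC c) (hC d) p 0 (hp c) (hp d) (by simp [hem])
        rw [← hl] at h1
        have := pow_le_pow_left₀ h0 h1 5
        refine this.trans (le_of_eq (by ring))
    refine (Finset.sum_le_sum fun i _ => Finset.sum_le_sum fun j _ => key i j).trans (le_of_eq ?_)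
    simp [Finset.sum_add_distrib, ← hM]
    ring
  have hV : ProbabilityTheory.variance Z P ≤ M * (l ^ 2 + l) ^ 5 := by
    rw [ProbabilityTheory.variance_eq_sub hL, hE]
    simp only [Pi.pow_apply]
    linarith
  have hpos : 0 < M * l ^ 5 := by positivity
  have hch := ProbabilityTheory.meas_ge_le_variance_div_sq hL hpos
  rw [hE] at hch
  refine (measure_mono ?_).trans (hch.trans ?_)
  · intro y hy
    have hz : Z y = 0 := by
      by_contra h
      apply hy
      obtain ⟨c, -, hc⟩ := Finset.exists_ne_zero_of_sum_ne_zero h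
      rw [Finset.prod_ne_zero_iff] at hc
      refine ⟨c, fun g => ?_⟩
      obtain ⟨i, -, hi⟩ := Finset.exists_ne_zero_of_sum_ne_zero (hc g (Finset.mem_univ _))
      exact ⟨i, Set.mem_of_indicator_ne_zero hi⟩
    show M * l ^ 5 ≤ |Z y - M * l ^ 5|
    rw [hz, zero_sub, abs_neg, abs_of_pos hpos]
  · gcongr
end second

theorem clique_bound (n m k : ℕ) (r : ℝ) (hm : 0 < m) (hmn : 5 * m ≤ n) (hmk : m ≤ k ^ 2)
    (hkr : 2 / (k : ℝ) ≤ r) :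
    sqMeasure n {x | ∃ S : Finset (Fin n), (geomGraph n r x).IsNClique 5 S}ᶜ ≤
      ENNReal.ofReal (32 * (k : ℝ) ^ 8 / (m : ℝ) ^ 5) := by
  have hk : 0 < k := by
    rcases Nat.eq_zero_or_pos k with h | h
    · subst h; simp at hmk; omega
    · exact h
  have hk' : (0 : ℝ) < k := by exact_mod_cast hk
  have hm' : (0 : ℝ) < m := by exact_mod_cast hm
  let f : Fin 5 × Fin m → Fin n := fun p => Fin.castLE hmn (finProdFinEquiv p)
  have hf : Function.Injective f := (Fin.castLE_injective hmn).comp finProdFinEquiv.injective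
  have hmp := (pi_map_curry' ((volume : Measure EE).restrict unitSquare) (Fin 5) (Fin m)).comp
    (pi_map_inj ((volume : Measure EE).restrict unitSquare) f hf)
  have hsm := second_moment ((volume : Measure EE).restrict unitSquare) (m := m) (cell k)
    (cell_meas k) (cell_disj k) (1 / (k : ℝ) ^ 2) ((k : ℝ) ^ 2) (m * (1 / (k : ℝ) ^ 2))
    (cell_vol k) (by simp) rfl (by positivity) (by positivity)
  have hmeas : MeasurableSet {y : Fin 5 → Fin m → EE | ¬ ∃ c, ∀ g, ∃ i, y g i ∈ cell k c} := by
    have : {y : Fin 5 → Fin m → EE | ¬ ∃ c, ∀ g, ∃ i, y g i ∈ cell k c} =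
        (⋃ c, ⋂ g, ⋃ i, (fun y : Fin 5 → Fin m → EE => y g i) ⁻¹' cell k c)ᶜ := by
      ext y; simp
    rw [this]
    refine (MeasurableSet.iUnion fun c => MeasurableSet.iInter fun g => MeasurableSet.iUnion fun i =>
      ?_).compl
    have : Measurable fun y : Fin 5 → Fin m → EE => y g i := by fun_prop
    exact this (cell_meas k c)
  rw [← hmp.measure_preimage hmeas.nullMeasurableSet] at hsm
  refine (measure_mono ?_).trans (hsm.trans ?_)
  · intro x hx hex
    apply hx
    obtain ⟨c, hc⟩ := hex
    choose i hi using hc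
    have hi' : ∀ g, x (f (g, i g)) ∈ cell k c := hi
    have hinj : Function.Injective fun g => f (g, i g) := by
      intro g g' h
      exact congrArg Prod.fst (hf h)
    refine ⟨Finset.univ.image fun g => f (g, i g), ?_, ?_⟩
    · intro u hu v hv huv
      simp only [Finset.coe_image, Finset.coe_univ, Set.image_univ, Set.mem_range] at hu hv
      obtain ⟨g, rfl⟩ := hu
      obtain ⟨g', rfl⟩ := hv
      exact ⟨huv, (cell_dist k c _ _ (hi' g) (hi' g')).trans hkr⟩
    · rw [Finset.card_image_of_injective _ hinj]; simp
  · apply ENNReal.ofReal_le_ofReal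
    set l : ℝ := m * (1 / (k : ℝ) ^ 2) with hl
    have hl0 : 0 < l := by positivity
    have hmk' : (m : ℝ) ≤ (k : ℝ) ^ 2 := by exact_mod_cast hmk
    have hl1 : l ≤ 1 := by
      rw [hl, mul_one_div, div_le_one (by positivity)]; exact hmk'
    have h1 : (l ^ 2 + l) ^ 5 ≤ (2 * l) ^ 5 := by
      gcongr; nlinarith
    calc (k : ℝ) ^ 2 * (l ^ 2 + l) ^ 5 / ((k : ℝ) ^ 2 * l ^ 5) ^ 2
        ≤ (k : ℝ) ^ 2 * (2 * l) ^ 5 / ((k : ℝ) ^ 2 * l ^ 5) ^ 2 := by gcongr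
      _ = 32 * (k : ℝ) ^ 8 / (m : ℝ) ^ 5 := by
        rw [hl]; field_simp; ring

theorem comp_bound (n : ℕ) (r : ℝ) (hr : 0 < r) :
    sqMeasure n {x | ∀ C : (geomGraph n r x).ConnectedComponent, Nat.card C.supp ≤ 4}ᶜ ≤
      ENNReal.ofReal ((n : ℝ) ^ 5 * ((4 * r) ^ 2 * Real.pi) ^ 4) := by
  let B : (Fin 5 ↪ Fin n) → Set (Fin n → EE) := fun f =>
    (fun (x : Fin n → EE) (j : Fin 5) => x (f j)) ⁻¹' {y | ∀ j, dist (y 0) (y j) ≤ 4 * r}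
  have hsub : {x | ∀ C : (geomGraph n r x).ConnectedComponent, Nat.card C.supp ≤ 4}ᶜ ⊆
      ⋃ f, B f := by
    intro x hx
    simp only [Set.mem_compl_iff, Set.mem_ofPred_eq, not_forall, not_le] at hx
    obtain ⟨C, hC⟩ := hx
    obtain ⟨v, hv⟩ := C.nonempty_supp
    obtain ⟨S, -, hc, hvS, hd⟩ := comp_large r x hr C v hv 4 hC
    -- enumerate S with v first
    have e : Fin 5 ≃ S := (Finset.equivFinOfCardEq hc).symm
    let e' : Fin 5 ≃ S := (Equiv.swap 0 (e.symm ⟨v, hvS⟩)).trans e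
    refine Set.mem_iUnion.2 ⟨e'.toEmbedding.trans (Function.Embedding.subtype _), ?_⟩
    intro j
    have h0 : ((e' 0 : S) : Fin n) = v := by simp [e']
    show dist (x (e' 0 : S)) (x (e' j : S)) ≤ 4 * r
    rw [h0]
    exact_mod_cast hd _ (e' j).2
  have hmeas : MeasurableSet {y : Fin 5 → EE | ∀ j, dist (y 0) (y j) ≤ 4 * r} := by
    simp only [Set.ofPred_forall]
    refine MeasurableSet.iInter fun j => ?_
    exact measurableSet_le (by fun_prop) (by fun_prop)
  have hB : ∀ f, sqMeasure n (B f) ≤ ENNReal.ofReal (((4 * r) ^ 2 * Real.pi) ^ 4) := by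
    intro f
    have h := (pi_map_inj ((volume : Measure EE).restrict unitSquare) f f.injective).measure_preimage
      hmeas.nullMeasurableSet
    unfold sqMeasure
    refine (le_of_eq h).trans ((star_meas_s13 _ Measure.restrict_le_self _).trans (le_of_eq ?_))
    rw [ENNReal.ofReal_pow (by positivity), ENNReal.ofReal_mul (p := (4 * r) ^ 2) (by positivity),
      ENNReal.ofReal_pow (p := 4 * r) (by positivity)]
  calc _ ≤ sqMeasure n (⋃ f, B f) := measure_mono hsub
    _ ≤ ∑ f, sqMeasure n (B f) := measure_iUnion_fintype_le _ _
    _ ≤ ∑ f : Fin 5 ↪ Fin n, ENNReal.ofReal (((4 * r) ^ 2 * Real.pi) ^ 4) :=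
        Finset.sum_le_sum fun f _ => hB f
    _ = (Fintype.card (Fin 5 ↪ Fin n) : ENNReal) * ENNReal.ofReal (((4 * r) ^ 2 * Real.pi) ^ 4) := by
        simp
    _ ≤ (n : ENNReal) ^ 5 * ENNReal.ofReal (((4 * r) ^ 2 * Real.pi) ^ 4) := by
        gcongr
        rw [Fintype.card_embedding_eq]
        simp only [Fintype.card_fin]
        exact_mod_cast Nat.descFactorial_le_pow n 5
    _ = _ := by
        rw [ENNReal.ofReal_mul (by positivity), ENNReal.ofReal_pow (by positivity)]
        simp

theorem tendsto_helper (A : ∀ n, Set (Fin n → EE)) (e : ℕ → ℝ) (he : Tendsto e atTop (nhds 0))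
    (h : ∀ᶠ n in atTop, sqMeasure n (A n)ᶜ ≤ ENNReal.ofReal (e n)) :
    Tendsto (fun n => sqMeasure n (A n)) atTop (nhds 1) := by
  have h1 : Tendsto (fun n => 1 - ENNReal.ofReal (e n)) atTop (nhds 1) := by
    have h2 := ENNReal.tendsto_ofReal he
    have := ENNReal.Tendsto.sub (tendsto_const_nhds (x := (1 : ENNReal)) (f := atTop)) h2
      (Or.inl (by simp))
    simpa using this
  refine tendsto_of_tendsto_of_tendsto_of_le_of_le' h1 tendsto_const_nhds ?_
    (Eventually.of_forall fun n => prob_le_one)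
  filter_upwards [h] with n hn
  rw [tsub_le_iff_right]
  calc (1 : ENNReal) = sqMeasure n Set.univ := by simp
    _ = sqMeasure n (A n ∪ (A n)ᶜ) := by simp
    _ ≤ sqMeasure n (A n) + sqMeasure n (A n)ᶜ := measure_union_le _ _
    _ ≤ _ := by gcongr

theorem pow58 (n : ℕ) : ((n : ℝ) ^ ((5 : ℝ) / 8)) ^ 8 = (n : ℝ) ^ 5 := by
  rw [← Real.rpow_natCast, ← Real.rpow_mul (by positivity), ← Real.rpow_natCast]
  norm_num

theorem planarity_threshold (r : ℕ → ℝ) (hrpos : ∀ n, 0 < r n) :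
    (Tendsto (fun n : ℕ => r n * (n : ℝ) ^ ((5 : ℝ) / 8)) atTop (nhds 0) →
      Tendsto
        (fun n : ℕ => sqMeasure n
          {x | ∀ C : (geomGraph n (r n) x).ConnectedComponent, Nat.card C.supp ≤ 4})
        atTop (nhds 1)) ∧
    (Tendsto (fun n : ℕ => r n * (n : ℝ) ^ ((5 : ℝ) / 8)) atTop atTop →
      Tendsto
        (fun n : ℕ => sqMeasure n
          {x | ∃ S : Finset (Fin n), (geomGraph n (r n) x).IsNClique 5 S})
        atTop (nhds 1)) := by
  constructor
  · intro h
    refine tendsto_helper _ (fun n => (n : ℝ) ^ 5 * ((4 * r n) ^ 2 * Real.pi) ^ 4) ?_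
      (Eventually.of_forall fun n => comp_bound n (r n) (hrpos n))
    have h2 := (h.pow 8).const_mul ((16 * Real.pi) ^ 4)
    simp only [ne_eq, OfNat.ofNat_ne_zero, not_false_eq_true, zero_pow, mul_zero] at h2
    refine h2.congr fun n => ?_
    rw [mul_pow (r n), pow58]
    ring
  · intro h
    let k : ℕ → ℕ := fun n => ⌈2 / r n⌉₊ + ⌈Real.sqrt n⌉₊
    have hk : Tendsto (fun n => (k n : ℝ) / (n : ℝ) ^ ((5 : ℝ) / 8)) atTop (nhds 0) := by
      have t1 : Tendsto (fun n : ℕ => 2 * (r n * (n : ℝ) ^ ((5 : ℝ) / 8))⁻¹) atTop (nhds 0) := by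
        simpa using h.inv_tendsto_atTop.const_mul 2
      have t2 : Tendsto (fun n : ℕ => (n : ℝ) ^ (-((1 : ℝ) / 8))) atTop (nhds 0) :=
        (tendsto_rpow_neg_atTop (by norm_num)).comp tendsto_natCast_atTop_atTop
      have t3 : Tendsto (fun n : ℕ => 2 * (n : ℝ) ^ (-((5 : ℝ) / 8))) atTop (nhds 0) := by
        simpa using ((tendsto_rpow_neg_atTop (y := (5 : ℝ) / 8) (by norm_num)).comp
          tendsto_natCast_atTop_atTop).const_mul 2
      have t := (t1.add t2).add t3
      simp only [add_zero] at t
      refine squeeze_zero' (Eventually.of_forall fun n => by positivity) ?_ t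
      filter_upwards [eventually_gt_atTop 0] with n hn
      have hn' : (0 : ℝ) < n := by exact_mod_cast hn
      have hr := hrpos n
      have a1 : (⌈2 / r n⌉₊ : ℝ) ≤ 2 / r n + 1 := (Nat.ceil_lt_add_one (by positivity)).le
      have a2 : (⌈Real.sqrt n⌉₊ : ℝ) ≤ Real.sqrt n + 1 := (Nat.ceil_lt_add_one (by positivity)).le
      have e2 : (n : ℝ) ^ (-((1 : ℝ) / 8)) = Real.sqrt n / (n : ℝ) ^ ((5 : ℝ) / 8) := by
        rw [Real.sqrt_eq_rpow, ← Real.rpow_sub hn']; norm_num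
      have e3 : (n : ℝ) ^ (-((5 : ℝ) / 8)) = 1 / (n : ℝ) ^ ((5 : ℝ) / 8) := by
        rw [Real.rpow_neg hn'.le, one_div]
      have hpos : 0 < (n : ℝ) ^ ((5 : ℝ) / 8) := by positivity
      rw [e2, e3]
      calc (k n : ℝ) / (n : ℝ) ^ ((5 : ℝ) / 8)
          ≤ (2 / r n + 1 + (Real.sqrt n + 1)) / (n : ℝ) ^ ((5 : ℝ) / 8) := by
            simp only [k]; push_cast; gcongr
        _ = _ := by field_simp; ring
    refine tendsto_helper _ (fun n => 3200000 * ((k n : ℝ) / (n : ℝ) ^ ((5 : ℝ) / 8)) ^ 8) ?_ ?_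
    · simpa using (hk.pow 8).const_mul 3200000
    · filter_upwards [eventually_ge_atTop 5] with n hn
      have hn' : (0 : ℝ) < n := by exact_mod_cast (by omega : 0 < n)
      have hr := hrpos n
      have hks : Real.sqrt n ≤ k n := by
        simp only [k]; push_cast
        have := Nat.le_ceil (Real.sqrt n)
        have : (0 : ℝ) ≤ ⌈2 / r n⌉₊ := by positivity
        linarith
      have hkr : 2 / r n ≤ k n := by
        simp only [k]; push_cast
        have := Nat.le_ceil (2 / r n)
        have : (0 : ℝ) ≤ ⌈Real.sqrt n⌉₊ := by positivity
        linarith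
      have hk0 : (0 : ℝ) < k n := lt_of_lt_of_le (by positivity) hkr
      refine (clique_bound n (n / 5) (k n) (r n) (by omega) (by omega) ?_ ?_).trans ?_
      · have : n ≤ k n ^ 2 := by
          have h1 := Real.sq_sqrt hn'.le
          have h2 : (n : ℝ) ≤ (k n : ℝ) ^ 2 := by
            rw [← h1]; gcongr
          exact_mod_cast h2
        omega
      · rw [div_le_iff₀ hk0]
        rwa [div_le_iff₀ hr, mul_comm] at hkr
      · apply ENNReal.ofReal_le_ofReal
        rw [div_pow, pow58]
        have h1 : (n : ℝ) / 10 ≤ ((n / 5 : ℕ) : ℝ) := by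
          have : n ≤ 10 * (n / 5) := by omega
          have : (n : ℝ) ≤ 10 * ((n / 5 : ℕ) : ℝ) := by exact_mod_cast this
          linarith
        calc 32 * (k n : ℝ) ^ 8 / ((n / 5 : ℕ) : ℝ) ^ 5 ≤ 32 * (k n : ℝ) ^ 8 / ((n : ℝ) / 10) ^ 5 := by
              gcongr
          _ = _ := by field_simp; norm_num
end
end

section
/- Let ε > 0 be a constant and let r : ℕ → ℝ be a positive function with n·r(n) → ∞ and n^{1/2+ε}·r(n) → 0 as n → ∞. Then the probability that the random geometric graph G(n, r(n)) has at least one free edge tends to 1 as n → ∞. -/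
open MeasureTheory Filter

noncomputable section

/-- An edge `{i,j}` of the random geometric graph is free if no other edge `{k,l}` of the
graph has its segment meeting the open segment between `x i` and `x j`
(the segment minus its endpoints). -/
def IsFreeEdge (n : ℕ) (r : ℝ) (x : Fin n → EuclideanSpace ℝ (Fin 2)) (i j : Fin n) : Prop :=
  (geomGraph n r x).Adj i j ∧
    ∀ k l : Fin n, (geomGraph n r x).Adj k l → ({k, l} : Finset (Fin n)) ≠ {i, j} →
      ∀ p ∈ segment ℝ (x k) (x l), ¬(p ∈ segment ℝ (x i) (x j) ∧ p ≠ x i ∧ p ≠ x j)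

abbrev EP := EuclideanSpace ℝ (Fin 2)

lemma vol_box (a : Fin 2 → ℝ) (s : ℝ) (hs : 0 ≤ s) :
    MeasurableSet {y : EP | ∀ i, y i ∈ Set.Icc (a i) (a i + s)} ∧
    volume {y : EP | ∀ i, y i ∈ Set.Icc (a i) (a i + s)} = ENNReal.ofReal (s ^ 2) := by
  have h := PiLp.volume_preserving_ofLp (Fin 2)
  have hm : MeasurableSet (Set.pi Set.univ (fun i : Fin 2 => Set.Icc (a i) (a i + s))) :=
    MeasurableSet.univ_pi (fun i => measurableSet_Icc)
  have e : {y : EP | ∀ i, y i ∈ Set.Icc (a i) (a i + s)} =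
      (@WithLp.ofLp 2 (Fin 2 → ℝ)) ⁻¹' (Set.pi Set.univ (fun i : Fin 2 => Set.Icc (a i) (a i + s))) := by
    ext y; simp only [Set.mem_ofPred_eq, Set.mem_preimage, Set.mem_pi, Set.mem_univ, true_imp_iff]
  rw [e]
  refine ⟨h.measurable hm, ?_⟩
  rw [h.measure_preimage hm.nullMeasurableSet, volume_pi_pi]
  simp [ENNReal.ofReal_pow hs]

lemma sq_eq : unitSquare = {y : EP | ∀ i, y i ∈ Set.Icc ((fun _ => 0 : Fin 2 → ℝ) i) ((fun _ => 0 : Fin 2 → ℝ) i + 1)} := by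
  ext y; simp [unitSquare]

lemma meas_sq : MeasurableSet unitSquare := by
  rw [sq_eq]; exact (vol_box _ 1 zero_le_one).1

instance probSq : IsProbabilityMeasure ((volume : Measure EP).restrict unitSquare) := by
  refine ⟨?_⟩
  rw [Measure.restrict_apply_univ, sq_eq, (vol_box _ 1 zero_le_one).2]; simp

instance probPi (n : ℕ) : IsProbabilityMeasure (sqMeasure n) := by
  unfold sqMeasure; infer_instance

lemma key {n : ℕ} (j : Fin (n + 1)) (T : Set (Fin (n + 1) → EP)) (hT : MeasurableSet T)
    (S : Set (Fin n → EP)) (c : ENNReal) (hS : ∀ x ∈ T, (fun i => x (j.succAbove i)) ∈ S)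
    (hc : ∀ z ∈ S, (volume : Measure EP).restrict unitSquare
      {y | j.insertNth (α := fun _ => EP) y z ∈ T} ≤ c) :
    sqMeasure (n + 1) T ≤ c * sqMeasure n S := by
  have h := measurePreserving_piFinSuccAbove
    (fun _ : Fin (n + 1) => (volume : Measure EP).restrict unitSquare) j
  have h' := h.symm
  have hT' := (MeasurableEquiv.piFinSuccAbove (fun _ : Fin (n+1) => EP) j).symm.measurable hT
  have e : sqMeasure (n + 1) T = _ := (h'.measure_preimage hT.nullMeasurableSet).symm
  rw [e, Measure.prod_apply_symm hT']
  refine le_trans (lintegral_mono (g := S.indicator (fun _ => c)) fun z => ?_)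
    (lintegral_indicator_const_le _ _)
  by_cases hz : z ∈ S
  · rw [Set.indicator_of_mem hz]
    exact hc z hz
  · rw [Set.indicator_of_notMem hz, nonpos_iff_eq_zero]
    convert measure_empty (μ := (volume : Measure EP).restrict unitSquare)
    ext y
    simp only [Set.mem_preimage, Set.mem_empty_iff_false, iff_false]
    intro hy
    apply hz
    have := hS _ hy
    have e2 : (fun i => ((MeasurableEquiv.piFinSuccAbove (fun _ : Fin (n+1) => EP) j).symm (y, z))
        (j.succAbove i)) = z := by
      funext i
      exact Fin.insertNth_apply_succAbove (α := fun _ => EP) j y z i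
    rwa [e2] at this

lemma pair_bound {n : ℕ} (r : ℝ) (hr : 0 ≤ r) (S : Set (Fin n → EP)) (j : Fin (n + 1)) (i : Fin n)
    (hS : MeasurableSet S) :
    sqMeasure (n + 1) {x | dist (x (j.succAbove i)) (x j) ≤ r ∧ (fun i => x (j.succAbove i)) ∈ S}
      ≤ ENNReal.ofReal (Real.pi * r ^ 2) * sqMeasure n S := by
  refine key j _ ?_ S _ (fun x hx => hx.2) ?_
  · refine MeasurableSet.inter (s₁ := {x : Fin (n+1) → EP | dist (x (j.succAbove i)) (x j) ≤ r})
      (measurableSet_le (by fun_prop) (by fun_prop)) ?_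
    exact measurable_pi_lambda _ (fun i => measurable_pi_apply _) hS
  · intro z hz
    refine (Measure.restrict_apply_le _ _).trans ?_
    refine (measure_mono (t := Metric.closedBall (z i) r) ?_).trans ?_
    · intro y hy
      simpa [dist_comm] using hy.1
    · rw [EuclideanSpace.volume_closedBall_fin_two, mul_comm Real.pi,
        ENNReal.ofReal_mul (by positivity), ENNReal.ofReal_pow hr]

lemma triple_bound (n : ℕ) (r : ℝ) (hr : 0 ≤ r) (i j k : Fin n) (hij : i ≠ j) (hik : i ≠ k)
    (hjk : j ≠ k) :
    sqMeasure n {x | dist (x i) (x j) ≤ r ∧ dist (x i) (x k) ≤ r} ≤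
      ENNReal.ofReal ((Real.pi * r ^ 2) ^ 2) := by
  obtain _ | _ | n := n
  · exact i.elim0
  · exact absurd (Fin.ext (by omega)) hij
  obtain ⟨i', rfl⟩ := Fin.exists_succAbove_eq hij
  obtain ⟨k', rfl⟩ := Fin.exists_succAbove_eq hjk.symm
  have h : i' ≠ k' := fun h => hik (by rw [h])
  obtain ⟨i'', rfl⟩ := Fin.exists_succAbove_eq h
  have h2 := pair_bound r hr (Set.univ : Set (Fin n → EP)) k' i'' MeasurableSet.univ
  have h1 := pair_bound r hr
    {x : Fin (n+1) → EP | dist (x (k'.succAbove i'')) (x k') ≤ r ∧ (fun i => x (k'.succAbove i)) ∈ (Set.univ : Set (Fin n → EP))}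
    j (k'.succAbove i'') (by
      simp only [Set.mem_univ, and_true]
      exact measurableSet_le (by fun_prop) (by fun_prop))
  refine (measure_mono ?_).trans (h1.trans ((mul_le_mul_right h2 _).trans ?_))
  · intro x hx
    exact ⟨hx.1, hx.2, trivial⟩
  · rw [measure_univ, mul_one, ← ENNReal.ofReal_mul (by positivity), ← sq]

def SepEv (n k : ℕ) (r : ℝ) : Set (Fin n → EP) :=
  {x | (∀ i, x i ∈ unitSquare) ∧
    ∀ i j : Fin n, i.val < k → j.val < k → i ≠ j → r < dist (x i) (x j)}

lemma meas_sep (n k : ℕ) (r : ℝ) : MeasurableSet (SepEv n k r) := by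
  have : SepEv n k r = (⋂ i : Fin n, (fun x : Fin n → EP => x i) ⁻¹' unitSquare) ∩
    ⋂ (i : Fin n) (j : Fin n) (_ : i.val < k) (_ : j.val < k) (_ : i ≠ j),
      {x : Fin n → EP | r < dist (x i) (x j)} := by
    ext x; simp [SepEv]
  rw [this]
  refine MeasurableSet.inter (MeasurableSet.iInter fun i => measurable_pi_apply i meas_sq) ?_
  refine MeasurableSet.iInter fun i => MeasurableSet.iInter fun j => MeasurableSet.iInter fun _ =>
    MeasurableSet.iInter fun _ => MeasurableSet.iInter fun _ =>
    measurableSet_lt (by fun_prop) (by fun_prop)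

lemma exists_box (r : ℝ) (hr : 0 < r) (hr1 : r ≤ 1) (z : EP) (hz : z ∈ unitSquare) :
    ∃ B : Set EP, MeasurableSet B ∧ B ⊆ unitSquare ∧ (∀ y ∈ B, dist y z ≤ r / 2) ∧
      volume B = ENNReal.ofReal (r ^ 2 / 16) := by
  let a : Fin 2 → ℝ := fun i => if z i ≤ 1 / 2 then z i else z i - r / 4
  obtain ⟨h1, h2⟩ := vol_box a (r / 4) (by positivity)
  have ha : ∀ (y : ℝ) i, y ∈ Set.Icc (a i) (a i + r / 4) → 0 ≤ y ∧ y ≤ 1 ∧ (y - z i) ^ 2 ≤ (r/4) ^ 2 := by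
    intro y i hy
    have hzi := hz i
    simp only [a, Set.mem_Icc] at hy hzi
    split_ifs at hy with h
    · refine ⟨by linarith, by linarith, ?_⟩
      apply sq_le_sq'  <;> linarith
    · refine ⟨by linarith, by linarith, ?_⟩
      apply sq_le_sq'  <;> linarith
  refine ⟨_, h1, ?_, ?_, ?_⟩
  · intro y hy i
    exact ⟨(ha _ i (hy i)).1, (ha _ i (hy i)).2.1⟩
  · intro y hy
    have u := (ha _ 0 (hy 0)).2.2
    have v := (ha _ 1 (hy 1)).2.2
    rw [EuclideanSpace.dist_eq, Fin.sum_univ_two, Real.dist_eq, Real.dist_eq, sq_abs, sq_abs]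
    apply Real.sqrt_le_iff.2 ⟨by positivity, by nlinarith⟩
  · rw [h2]; congr 1; ring

lemma sep_step (n k : ℕ) (hk : k ≤ n) (r : ℝ) (hr : 0 < r) (hr1 : r ≤ 1) :
    sqMeasure (n + 1) (SepEv (n + 1) (k + 1) r) ≤
      ENNReal.ofReal (Real.exp (-(r ^ 2 / 16 * k))) * sqMeasure n (SepEv n k r) := by
  refine key 0 _ (meas_sep _ _ _) _ _ ?_ ?_
  · intro x hx
    refine ⟨fun i => hx.1 _, fun i j hi hj hij => hx.2 _ _ ?_ ?_ ?_⟩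
    · simpa using hi
    · simpa using hj
    · simpa using hij
  · intro z hz
    choose B hB1 hB2 hB3 hB4 using fun i => exists_box r hr hr1 (z i) (hz.1 i)
    let J : Finset (Fin n) := Finset.univ.filter (fun i => i.val < k)
    have hJ : J.card = k := by
      simp only [J]
      rw [Fin.card_filter_val_lt, min_eq_right hk]
    let U := ⋃ i ∈ J, B i
    have hUm : MeasurableSet U := Finset.measurableSet_biUnion _ (fun i _ => hB1 i)
    have hU : (volume : Measure EP).restrict unitSquare U = ENNReal.ofReal (r ^ 2 / 16 * k) := by
      rw [Measure.restrict_eq_self _ (Set.iUnion₂_subset fun i _ => hB2 i)]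
      rw [measure_biUnion_finset ?_ (fun i _ => hB1 i)]
      · simp only [hB4, Finset.sum_const, hJ, nsmul_eq_mul]
        rw [mul_comm (r ^ 2 / 16), ENNReal.ofReal_mul (by positivity), ENNReal.ofReal_natCast]
      · intro i hi j hj hij
        refine Set.disjoint_left.2 fun y hy1 hy2 => ?_
        have := hz.2 i j (by simpa [J] using hi) (by simpa [J] using hj) hij
        have h1 := hB3 i y hy1
        have h2 := hB3 j y hy2
        have := dist_triangle_left (z i) (z j) y
        linarith
    refine (measure_mono (t := Uᶜ) ?_).trans ?_
    · intro y hy hyU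
      obtain ⟨i, hi, hyi⟩ := Set.mem_iUnion₂.1 hyU
      have h1 := hB3 i y hyi
      have h2 := hy.2 0 i.succ (by simp) (by simpa [J] using hi) (Fin.succ_ne_zero i).symm
      simp at h2
      linarith
    · rw [prob_compl_eq_one_sub hUm, hU, ← ENNReal.ofReal_one, ← ENNReal.ofReal_sub _ (by positivity)]
      apply ENNReal.ofReal_le_ofReal
      have := Real.add_one_le_exp (-(r ^ 2 / 16 * k))
      linarith

lemma sep_bound (r : ℝ) (hr : 0 < r) (hr1 : r ≤ 1) (k : ℕ) : ∀ n, k ≤ n → 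
    sqMeasure n (SepEv n k r) ≤ ENNReal.ofReal (Real.exp (-(r ^ 2 / 32 * (k * (k - 1))))) := by
  induction k with
  | zero => intro n _; simpa using prob_le_one
  | succ k ih =>
    intro n hn
    obtain _ | n := n
    · omega
    refine (sep_step n k (by omega) r hr hr1).trans
      ((mul_le_mul_right (ih n (by omega)) _).trans ?_)
    rw [← ENNReal.ofReal_mul (by positivity), ← Real.exp_add]
    apply ENNReal.ofReal_le_ofReal
    apply Real.exp_le_exp.2
    push_cast
    apply le_of_eq
    ring

lemma not_free (n : ℕ) (r : ℝ) (x : Fin n → EP) (i j : Fin n) (hij : i ≠ j)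
    (hd : dist (x i) (x j) ≤ r) (h : ¬ IsFreeEdge n r x i j) :
    ∃ m, m ≠ i ∧ m ≠ j ∧ (dist (x i) (x m) ≤ r ∨ dist (x j) (x m) ≤ r) := by
  unfold IsFreeEdge at h
  push Not at h
  obtain ⟨k, l, hkl, hne, p, hp, hp2, -⟩ := h ⟨hij, hd⟩
  obtain ⟨hkl, hd2⟩ := hkl
  have e1 := dist_add_dist_of_mem_segment hp
  have e2 := dist_add_dist_of_mem_segment hp2
  by_contra! hcon
  have a1 := dist_triangle_right (x i) (x k) p
  have a2 := dist_triangle (x i) p (x l)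
  have a3 := dist_triangle_left (x j) (x k) p
  have a4 := dist_triangle_left (x j) (x l) p
  rw [dist_comm (x j) (x k), dist_comm p (x k)] at a3
  rw [dist_comm p (x j)] at a4
  have hk := hcon k
  have hl := hcon l
  have c1 := dist_comm (x k) (x l)
  have c2 := dist_comm (x j) (x k)
  have c3 := dist_comm (x j) p
  have c4 := dist_comm (x l) p
  by_cases h1 : k = i
  · subst h1
    by_cases h2 : l = j
    · subst h2; exact hne rfl
    · have := hl hkl.symm h2; linarith
  by_cases h2 : k = j
  · subst h2
    by_cases h2 : l = i
    · subst h2; exact hne (Finset.pair_comm _ _)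
    · have := hl h2 hkl.symm; linarith
  have := hk h1 h2
  by_cases h3 : l = i
  · subst h3; linarith
  by_cases h4 : l = j
  · subst h4; linarith
  have := hl h3 h4
  linarith

lemma main_bound (n m : ℕ) (hm : m ≤ n) (r : ℝ) (hr : 0 < r) (hr1 : r ≤ 1) :
    1 ≤ sqMeasure n {x | ∃ i j : Fin n, IsFreeEdge n r x i j} +
      (ENNReal.ofReal (Real.exp (-(r ^ 2 / 32 * (m * (m - 1))))) +
       ENNReal.ofReal ((m : ℝ) ^ 2 * n * (Real.pi * r ^ 2) ^ 2)) := by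
  let Out : Set (Fin n → EP) := {x | ¬ ∀ i, x i ∈ unitSquare}
  have hOut : sqMeasure n Out = 0 := by
    have : ∀ᵐ x ∂(sqMeasure n), ∀ i, x i ∈ unitSquare := by
      rw [ae_all_iff]
      intro i
      exact (Measure.quasiMeasurePreserving_eval _ i).ae (ae_restrict_mem meas_sq)
    exact this
  let J : Finset (Fin n) := Finset.univ.filter (fun i => i.val < m)
  have hJ : J.card = m := by
    simp only [J]
    rw [Fin.card_filter_val_lt, min_eq_right hm]
  let T : Fin n → Fin n → Fin n → Set (Fin n → EP) := fun i j k =>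
    {x | (i ≠ j ∧ i ≠ k ∧ j ≠ k) ∧ dist (x i) (x j) ≤ r ∧ dist (x i) (x k) ≤ r}
  let W : Set (Fin n → EP) := ⋃ i ∈ J, ⋃ j ∈ J, ⋃ k ∈ (Finset.univ : Finset (Fin n)), T i j k
  have hT : ∀ i j k, sqMeasure n (T i j k) ≤ ENNReal.ofReal ((Real.pi * r ^ 2) ^ 2) := by
    intro i j k
    by_cases h : i ≠ j ∧ i ≠ k ∧ j ≠ k
    · refine (measure_mono ?_).trans (triple_bound n r hr.le i j k h.1 h.2.1 h.2.2)
      intro x hx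
      exact hx.2
    · have : T i j k = ∅ := by
        ext x; simp only [T, Set.mem_ofPred_eq, Set.mem_empty_iff_false]; tauto
      rw [this]; simp
  have hW : sqMeasure n W ≤ ENNReal.ofReal ((m : ℝ) ^ 2 * n * (Real.pi * r ^ 2) ^ 2) := by
    have : sqMeasure n W ≤ ∑ i ∈ J, ∑ j ∈ J, ∑ k : Fin n, ENNReal.ofReal ((Real.pi * r ^ 2) ^ 2) := by
      refine (measure_biUnion_finset_le _ _).trans (Finset.sum_le_sum fun i _ => ?_)
      refine (measure_biUnion_finset_le _ _).trans (Finset.sum_le_sum fun j _ => ?_)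
      exact (measure_biUnion_finset_le _ _).trans (Finset.sum_le_sum fun k _ => hT i j k)
    refine this.trans (le_of_eq ?_)
    simp only [Finset.sum_const, hJ, Finset.card_univ, Fintype.card_fin, nsmul_eq_mul]
    rw [ENNReal.ofReal_mul (by positivity), ENNReal.ofReal_mul (by positivity),
      ENNReal.ofReal_pow (p := (m : ℝ)) (by positivity), ENNReal.ofReal_natCast,
      ENNReal.ofReal_natCast]
    ring
  have hcover : (Set.univ : Set (Fin n → EP)) ⊆
      {x | ∃ i j : Fin n, IsFreeEdge n r x i j} ∪ (Out ∪ (SepEv n m r ∪ W)) := by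
    intro x _
    by_contra hx
    simp only [Set.mem_union, not_or] at hx
    obtain ⟨h1, h2, h3, h4⟩ := hx
    apply h3
    refine ⟨not_not.1 h2, fun i j hi hj hij => ?_⟩
    by_contra hd
    push Not at hd
    apply h4
    have hi' : i ∈ J := by simp [J, hi]
    have hj' : j ∈ J := by simp [J, hj]
    obtain ⟨k, hk1, hk2, hk | hk⟩ := not_free n r x i j hij hd (fun h => h1 ⟨i, j, h⟩)
    · simp only [W, Set.mem_iUnion]
      exact ⟨i, hi', j, hj', k, Finset.mem_univ _, ⟨hij, hk1.symm, hk2.symm⟩, hd, hk⟩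
    · simp only [W, Set.mem_iUnion]
      exact ⟨j, hj', i, hi', k, Finset.mem_univ _, ⟨hij.symm, hk2.symm, hk1.symm⟩,
        by rwa [dist_comm], hk⟩
  calc (1 : ENNReal) = sqMeasure n Set.univ := measure_univ.symm
    _ ≤ _ := measure_mono hcover
    _ ≤ _ := measure_union_le _ _
    _ ≤ _ := by
      gcongr
      refine (measure_union_le _ _).trans ?_
      rw [hOut, zero_add]
      refine (measure_union_le _ _).trans ?_
      exact add_le_add (sep_bound r hr hr1 m n hm) hW

theorem exists_free_edge (ε : ℝ) (hε : 0 < ε) (r : ℕ → ℝ) (hrpos : ∀ n, 0 < r n)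
    (hr1 : Tendsto (fun n : ℕ => (n : ℝ) * r n) atTop atTop)
    (hr2 : Tendsto (fun n : ℕ => (n : ℝ) ^ ((1 : ℝ) / 2 + ε) * r n) atTop (nhds 0)) :
    Tendsto
      (fun n : ℕ => sqMeasure n {x | ∃ i j : Fin n, IsFreeEdge n (r n) x i j})
      atTop (nhds 1) := by
  have hsmall : ∀ η : ℝ, 0 < η → ∀ᶠ n : ℕ in atTop, r n < η ∧ (n : ℝ) * r n ^ 2 < η := by
    intro η hη
    have h0 : 0 < min η 1 := lt_min hη one_pos
    filter_upwards [hr2.eventually (gt_mem_nhds h0), eventually_ge_atTop 1] with n hn hn1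
    have hn1' : (1 : ℝ) ≤ n := by exact_mod_cast hn1
    have hr0 := hrpos n
    set u := (n : ℝ) ^ ((1 : ℝ) / 2 + ε) with hu
    have hu1 : 1 ≤ u := Real.one_le_rpow hn1' (by positivity)
    have hu2 : (n : ℝ) ≤ u ^ 2 := by
      rw [hu, ← Real.rpow_natCast, ← Real.rpow_mul (by positivity)]
      exact Real.self_le_rpow_of_one_le hn1' (by push_cast; linarith)
    have hη' := min_le_left η 1
    have h1' := min_le_right η 1
    have hur : 0 < u * r n := by positivity
    constructor
    · nlinarith
    · calc (n : ℝ) * r n ^ 2 ≤ u ^ 2 * r n ^ 2 := by gcongr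
        _ = (u * r n) * (u * r n) := by ring
        _ ≤ (u * r n) * 1 := by gcongr; linarith
        _ < η := by linarith
  refine tendsto_order.2 ⟨fun a ha => ?_, fun a ha => Eventually.of_forall fun n =>
    lt_of_le_of_lt prob_le_one ha⟩
  have hat : a ≠ ⊤ := ne_top_of_lt ha
  lift a to NNReal using hat
  have ha' : (a : ℝ) < 1 := by exact_mod_cast ha
  set δ : ℝ := 1 - a with hδ
  have hδ0 : 0 < δ := by linarith
  have hexp : Tendsto (fun M : ℝ => Real.exp (-(M ^ 2 / 64))) atTop (nhds 0) :=
    Real.tendsto_exp_neg_atTop_nhds_zero.comp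
      ((tendsto_pow_atTop two_ne_zero).atTop_div_const (by norm_num))
  obtain ⟨M, hM, hM1⟩ := ((hexp.eventually (gt_mem_nhds (half_pos hδ0))).and
    (eventually_ge_atTop (1 : ℝ))).exists
  have hη : 0 < min (1 / 2) (δ / 2 / (4 * M ^ 2 * Real.pi ^ 2)) := by positivity
  filter_upwards [hsmall _ hη, hr1.eventually_ge_atTop (2 * M)] with n hn hn2
  obtain ⟨hn1, hn3⟩ := hn
  have hr0 := hrpos n
  have hrh : r n < 1 / 2 := lt_of_lt_of_le hn1 (min_le_left _ _)
  have hn4 : (n : ℝ) * r n ^ 2 < δ / 2 / (4 * M ^ 2 * Real.pi ^ 2) :=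
    lt_of_lt_of_le hn3 (min_le_right _ _)
  set m := ⌈M / r n⌉₊ with hm
  have hm1 : M ≤ m * r n := by
    rw [← div_le_iff₀ hr0]; exact Nat.le_ceil _
  have hm2 : m * r n ≤ M + r n := by
    have := (Nat.ceil_lt_add_one (a := M / r n) (by positivity)).le
    calc m * r n ≤ (M / r n + 1) * r n := by gcongr
      _ = M + r n := by field_simp
  have hmn : m ≤ n := by
    have : (m : ℝ) * r n ≤ n * r n := by linarith
    exact_mod_cast le_of_mul_le_mul_right this hr0
  have hb := main_bound n m hmn (r n) hr0 (by linarith)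
  have hA : Real.exp (-(r n ^ 2 / 32 * (m * (m - 1)))) < δ / 2 := by
    refine lt_of_le_of_lt (Real.exp_le_exp.2 ?_) hM
    have : M * (M / 2) ≤ (m * r n) * (m * r n - r n) := by
      apply mul_le_mul hm1 _ (by positivity) (by positivity)
      linarith
    nlinarith
  have hB : (m : ℝ) ^ 2 * n * (Real.pi * r n ^ 2) ^ 2 < δ / 2 := by
    calc (m : ℝ) ^ 2 * n * (Real.pi * r n ^ 2) ^ 2
        = (m * r n) ^ 2 * Real.pi ^ 2 * (n * r n ^ 2) := by ring
      _ ≤ (2 * M) ^ 2 * Real.pi ^ 2 * (n * r n ^ 2) := by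
        have h2M : m * r n ≤ 2 * M := by linarith
        have hp : 0 ≤ m * r n := by positivity
        have := pow_le_pow_left₀ hp h2M 2
        exact mul_le_mul_of_nonneg_right (mul_le_mul_of_nonneg_right this (by positivity))
          (by positivity)
      _ = (n * r n ^ 2) * (4 * M ^ 2 * Real.pi ^ 2) := by ring
      _ < δ / 2 := by rwa [← lt_div_iff₀ (by positivity)]
  rw [← ENNReal.ofReal_add (by positivity) (by positivity)] at hb
  by_contra! hcon
  have h2 : (1 : ENNReal) ≤ ENNReal.ofReal ((a : ℝ) +
      (Real.exp (-(r n ^ 2 / 32 * (m * (m - 1)))) + (m : ℝ) ^ 2 * n * (Real.pi * r n ^ 2) ^ 2)) := by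
    rw [ENNReal.ofReal_add (by positivity) (by positivity), ENNReal.ofReal_coe_nnreal]
    exact hb.trans (add_le_add hcon le_rfl)
  rw [ENNReal.one_le_ofReal] at h2
  linarith
end
end

section
/- Let c > 16/π be a constant. Let k : ℕ → ℕ and r : ℕ → ℝ be functions with ln n ≤ k(n) ≤ n and r(n) ≥ √( c · ln(e·n / k(n)) / k(n) ) for all sufficiently large n. Then the probability that the toroidal random geometric graph G(n, r(n)) contains an independent set of size k(n) tends to 0 as n → ∞. -/
open MeasureTheory Filter

noncomputable section

/-- The half-open unit square `[0,1)²`, viewed as the unit flat torus. -/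
def torusSquare : Set (EuclideanSpace ℝ (Fin 2)) := {x | ∀ i, x i ∈ Set.Ico (0 : ℝ) 1}

/-- The distribution of `n` independent uniform points on `[0,1)²`. -/
def torusMeasure (n : ℕ) : Measure (Fin n → EuclideanSpace ℝ (Fin 2)) :=
  Measure.pi fun _ => volume.restrict torusSquare

/-- The toroidal distance: `d(x,y)` is the infimum of `‖x - y + v‖` over
shifts `v ∈ {-1,0,1}²`. -/
def torusDist (x y : EuclideanSpace ℝ (Fin 2)) : ℝ :=
  sInf {d : ℝ | ∃ v : EuclideanSpace ℝ (Fin 2),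
    (∀ i, v i ∈ ({-1, 0, 1} : Set ℝ)) ∧ d = ‖x - y + v‖}

/-- The event that the toroidal random geometric graph with distance parameter `r` contains
an independent set of size `k`: `k` vertices, no two of which are within toroidal
distance `r`. -/
def HasIndepSet (n : ℕ) (r : ℝ) (k : ℕ) (x : Fin n → EuclideanSpace ℝ (Fin 2)) : Prop :=
  ∃ S : Finset (Fin n), S.card = k ∧
    ∀ i ∈ S, ∀ j ∈ S, i ≠ j → ¬ torusDist (x i) (x j) ≤ r

theorem torusDist_le_norm (x y : EuclideanSpace ℝ (Fin 2)) : torusDist x y ≤ ‖x - y‖ := by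
  apply csInf_le
  · refine ⟨0, ?_⟩
    rintro d ⟨v, -, rfl⟩
    exact norm_nonneg _
  · exact ⟨0, by simp, by simp⟩

theorem measurableSet_torusSquare : MeasurableSet torusSquare := by
  have : torusSquare = ⋂ i, (fun x : EuclideanSpace ℝ (Fin 2) => x i) ⁻¹' Set.Ico (0 : ℝ) 1 := by
    ext x; simp [torusSquare]
  rw [this]
  refine MeasurableSet.iInter fun i => ?_
  have hm : Measurable (fun x : EuclideanSpace ℝ (Fin 2) => x i) := by fun_prop
  exact hm measurableSet_Ico

theorem cell_close (m : ℕ) (hm : 0 < m) (a b : ℝ) (ha : 0 ≤ a) (hb : 0 ≤ b)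
    (h : ⌊a * m⌋₊ = ⌊b * m⌋₊) : (a - b) ^ 2 ≤ 1 / (m : ℝ) ^ 2 := by
  have hm' : (0 : ℝ) < m := by exact_mod_cast hm
  have h1 := Nat.floor_le (mul_nonneg ha hm'.le)
  have h2 := Nat.lt_floor_add_one (a * m)
  have h3 := Nat.floor_le (mul_nonneg hb hm'.le)
  have h4 := Nat.lt_floor_add_one (b * m)
  rw [h] at h1 h2
  rw [le_div_iff₀ (by positivity), ← mul_pow]
  have : |(a - b) * m| ≤ 1 := by
    rw [abs_le]; constructor <;> nlinarith
  exact (sq_le_one_iff_abs_le_one _).2 this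

theorem det_bound (n k : ℕ) (r : ℝ) (hk : 5 ≤ k) (hr : Real.sqrt (5 / k) ≤ r)
    (x : Fin n → EuclideanSpace ℝ (Fin 2)) (hx : ∀ i, x i ∈ torusSquare) :
    ¬ HasIndepSet n r k x := by
  rintro ⟨S, hS, hind⟩
  obtain ⟨m, hm2, hmk, hkm⟩ : ∃ m : ℕ, 2 ≤ m ∧ m * m < k ∧ k ≤ (m + 1) * (m + 1) := by
    refine ⟨Nat.sqrt (k - 1), ?_, ?_, ?_⟩
    · rw [Nat.le_sqrt]; omega
    · have := Nat.sqrt_le (k - 1); omega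
    · have := Nat.sqrt_lt_self (n := k - 1) (by omega)
      have := Nat.lt_succ_sqrt (k - 1)
      simp only [Nat.succ_eq_add_one] at this
      omega
  have hm0 : (0 : ℝ) < m := by exact_mod_cast (by omega : 0 < m)
  have hmaps : ∀ i ∈ S, (⌊x i 0 * m⌋₊, ⌊x i 1 * m⌋₊) ∈ Finset.range m ×ˢ Finset.range m := by
    intro i _
    have h := hx i
    have key : ∀ j, ⌊x i j * m⌋₊ < m := by
      intro j
      have := h j
      rw [Nat.floor_lt (mul_nonneg this.1 hm0.le)]
      nlinarith [this.2]
    simp [key]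
  obtain ⟨i, hi, j, hj, hij, heq⟩ := Finset.exists_ne_map_eq_of_card_lt_of_maps_to
    (by simpa [hS] using hmk) hmaps
  simp only [Prod.mk.injEq] at heq
  apply hind i hi j hj hij
  refine (torusDist_le_norm _ _).trans (le_trans ?_ hr)
  rw [EuclideanSpace.norm_eq]
  apply Real.sqrt_le_sqrt
  have e0 := cell_close m (by omega) _ _ (hx i 0).1 (hx j 0).1 heq.1
  have e1 := cell_close m (by omega) _ _ (hx i 1).1 (hx j 1).1 heq.2
  simp only [Fin.sum_univ_two, Real.norm_eq_abs, sq_abs, PiLp.sub_apply]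
  have hk0 : (0 : ℝ) < k := by exact_mod_cast (by omega : 0 < k)
  have : (2 : ℝ) / (m : ℝ) ^ 2 ≤ 5 / k := by
    rw [div_le_div_iff₀ (by positivity) hk0]
    have h1 : (k : ℝ) ≤ (m + 1) * (m + 1) := by exact_mod_cast hkm
    have h2 : (2 : ℝ) ≤ m := by exact_mod_cast hm2
    nlinarith
  have h2 : (2 : ℝ) / (m : ℝ) ^ 2 = 1 / (m : ℝ) ^ 2 + 1 / (m : ℝ) ^ 2 := by ring
  linarith

theorem no_large_indep_set (c : ℝ) (hc : 16 / Real.pi < c) (k : ℕ → ℕ) (r : ℕ → ℝ)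
    (hk : ∀ᶠ n : ℕ in atTop, Real.log n ≤ (k n : ℝ) ∧ k n ≤ n)
    (hr : ∀ᶠ n : ℕ in atTop,
      Real.sqrt (c * Real.log (Real.exp 1 * n / (k n : ℝ)) / (k n : ℝ)) ≤ r n) :
    Tendsto (fun n : ℕ => torusMeasure n {x | HasIndepSet n (r n) (k n) x})
      atTop (nhds 0) := by
  have hc5 : 5 ≤ c := by
    refine le_trans ?_ hc.le
    rw [le_div_iff₀ Real.pi_pos]
    nlinarith [Real.pi_lt_d2]
  have hlog : ∀ᶠ n : ℕ in atTop, (5 : ℝ) ≤ Real.log n :=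
    (Real.tendsto_log_atTop.comp tendsto_natCast_atTop_atTop).eventually_ge_atTop 5
  refine tendsto_const_nhds.congr' ?_
  filter_upwards [hk, hr, hlog] with n ⟨hk1, hk2⟩ hr hl
  symm
  have hk5 : 5 ≤ k n := by exact_mod_cast hl.trans hk1
  have hk0 : (0 : ℝ) < k n := by exact_mod_cast (by omega : 0 < k n)
  have hlog1 : 1 ≤ Real.log (Real.exp 1 * n / (k n : ℝ)) := by
    have hkn : (k n : ℝ) ≤ n := by exact_mod_cast hk2
    rw [Real.le_log_iff_exp_le (by have := hk0.trans_le hkn; positivity), le_div_iff₀ hk0]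
    gcongr
  have hr5 : Real.sqrt (5 / (k n : ℝ)) ≤ r n := by
    refine le_trans (Real.sqrt_le_sqrt ?_) hr
    gcongr
    nlinarith
  have hae : ∀ᵐ x ∂(torusMeasure n), ∀ i, x i ∈ torusSquare := by
    rw [ae_all_iff]
    intro i
    exact (Measure.tendsto_eval_ae_ae (i := i)).eventually
      (ae_restrict_mem measurableSet_torusSquare)
  have hfin : ∀ᵐ x ∂(torusMeasure n), ¬ HasIndepSet n (r n) (k n) x := by
    filter_upwards [hae] with x hx using det_bound n (k n) (r n) hk5 hr5 x hx
  simpa [ae_iff] using hfin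
end
end
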